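/- Generic chaining bound for max-of-linear-forms processes: There exists a universal constant C₀ > 0 with the following property. Let n, s, m ≥ 1, let A : ℝⁿ → ℝˢ be a linear map with rows a_1, …, a_s, and for each i ∈ [m] let S_i ⊆ [s] be nonempty and w^{(i)} ∈ [0,1]^{S_i}, defining φ_i(x) = max_{j ∈ S_i} w^{(i)}_j |⟨a_j, x⟩|. Let D = max_{i∈[m]} |S_i| and assume D ≥ 2. Then for every nonempty T ⊆ B₂ⁿ = {x ∈ ℝⁿ : ‖x‖ ≤ 1}, with ξ_1, …, ξ_m independent uniform ±1 random variables: E[ sup_{x∈T} Σ_{i=1}^m ξ_i φ_i(x)² ] ≤ C₀ · ‖A‖_{2→∞} · √(log(s+n) · log D) · sup_{x∈T} ( Σ_{i=1}^m φ_i(x)² )^{1/2}, where ‖A‖_{2→∞} := max{‖Ax‖_∞ : x ∈ B₂ⁿ}. -/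

import Mathlib

open Matrix BigOperators

/-- The Rademacher sum with coefficients `c`, evaluated at the sign pattern `ξ`. -/
noncomputable def signSum {m : ℕ} (c : Fin m → ℝ) (ξ : Fin m → Bool) : ℝ :=
  ∑ i, (if ξ i then (1 : ℝ) else -1) * c i

lemma signSum_sub {m : ℕ} (c c' : Fin m → ℝ) (ξ : Fin m → Bool) :
    signSum (fun i => c i - c' i) ξ = signSum c ξ - signSum c' ξ := by
  simp only [signSum, mul_sub, Finset.sum_sub_distrib]

lemma sum_prod_sign {m : ℕ} (g : Fin m → Bool → ℝ) :
    ∑ ξ : Fin m → Bool, ∏ i, g i (ξ i) = ∏ i, (g i true + g i false) := by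
  have := Finset.prod_univ_sum (fun _ : Fin m => (Finset.univ : Finset Bool)) g
  rw [Fintype.piFinset_univ] at this
  rw [← this]
  simp

lemma sum_exp_signSum_le {m : ℕ} (c : Fin m → ℝ) :
    ∑ ξ, Real.exp (signSum c ξ) ≤ 2 ^ m * Real.exp ((∑ i, c i ^ 2) / 2) := by
  have h : ∀ ξ : Fin m → Bool, Real.exp (signSum c ξ)
      = ∏ i, Real.exp ((if ξ i then (1 : ℝ) else -1) * c i) := by
    intro ξ; rw [signSum, Real.exp_sum]
  simp_rw [h]
  rw [sum_prod_sign (fun i b => Real.exp ((if b then (1 : ℝ) else -1) * c i)),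
    Finset.sum_div, Real.exp_sum]
  have h2 : (2 : ℝ) ^ m = ∏ _i : Fin m, (2 : ℝ) := by simp
  rw [h2, ← Finset.prod_mul_distrib]
  refine Finset.prod_le_prod (fun i _ => by positivity) fun i _ => ?_
  have := Real.cosh_le_exp_half_sq (c i)
  rw [Real.cosh_eq] at this
  simp only [if_true, Bool.false_eq_true, if_false, one_mul, neg_mul]
  linarith

lemma sum_exp_abs_signSum_le {m : ℕ} (c : Fin m → ℝ) :
    ∑ ξ, Real.exp |signSum c ξ| ≤ 2 * 2 ^ m * Real.exp ((∑ i, c i ^ 2) / 2) := by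
  have h1 := sum_exp_signSum_le c
  have h2 := sum_exp_signSum_le (fun i => -c i)
  have h3 : ∀ ξ, signSum (fun i => -c i) ξ = -signSum c ξ := by
    intro ξ; simp [signSum]
  simp only [h3, neg_sq] at h2
  calc ∑ ξ, Real.exp |signSum c ξ|
      ≤ ∑ ξ, (Real.exp (signSum c ξ) + Real.exp (-signSum c ξ)) := by
        refine Finset.sum_le_sum fun ξ _ => ?_
        rcases abs_cases (signSum c ξ) with h | h <;> rw [h.1] <;>
          [have := Real.exp_pos (-signSum c ξ); have := Real.exp_pos (signSum c ξ)] <;> linarith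
    _ ≤ _ := by rw [Finset.sum_add_distrib]; linarith

lemma sum_signSum (m : ℕ) (c : Fin m → ℝ) : ∑ ξ, signSum c ξ = 0 := by
  have h : ∀ ξ : Fin m → Bool, signSum c (fun i => !ξ i) = -signSum c ξ := by
    intro ξ
    simp only [signSum, ← Finset.sum_neg_distrib]
    refine Finset.sum_congr rfl fun i _ => ?_
    rcases Bool.eq_false_or_eq_true (ξ i) with h | h <;> simp [h]
  have e : Function.Involutive (fun (ξ : Fin m → Bool) i => !ξ i) := by
    intro ξ; simp
  have := Equiv.sum_comp e.toPerm (fun ξ => signSum c ξ)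
  simp only [Function.Involutive.coe_toPerm, h, Finset.sum_neg_distrib] at this
  linarith

lemma abs_signSum_le {m : ℕ} (c : Fin m → ℝ) (ξ : Fin m → Bool) :
    |signSum c ξ| ≤ √m * √(∑ i, c i ^ 2) := by
  have h1 : |signSum c ξ| ≤ ∑ i, 1 * |c i| := by
    refine (Finset.abs_sum_le_sum_abs _ _).trans (Finset.sum_le_sum fun i _ => ?_)
    rw [abs_mul]; split_ifs <;> simp
  have h2 := Finset.sum_mul_sq_le_sq_mul_sq Finset.univ (fun _ : Fin m => (1 : ℝ)) (fun i => |c i|)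
  simp only [one_pow, Finset.sum_const, Finset.card_univ, Fintype.card_fin, nsmul_eq_mul, mul_one,
    sq_abs] at h2
  rw [← Real.sqrt_mul (by positivity)]
  exact h1.trans (Real.le_sqrt_of_sq_le h2)

/-- Truncated first moment of a normalised Rademacher sum. -/
lemma sum_max_signSum_sub_le {m : ℕ} (c : Fin m → ℝ) {D : ℝ} (hD : 0 < D)
    (hc : ∑ i, c i ^ 2 ≤ D ^ 2) (k : ℕ) (L : ℝ) :
    ∑ ξ, max 0 (|signSum c ξ| / (2 ^ k * D) - L)
      ≤ 2 * 2 ^ m * Real.exp (4 ^ k * (1 / 2 - L)) := by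
  have h4 : (4 : ℝ) ^ k = 2 ^ k * 2 ^ k := by rw [← mul_pow]; norm_num
  have hk : (1 : ℝ) ≤ 4 ^ k := one_le_pow₀ (by norm_num)
  have key := sum_exp_abs_signSum_le (fun i => 2 ^ k / D * c i)
  have hs : ∀ ξ, signSum (fun i => 2 ^ k / D * c i) ξ = 2 ^ k / D * signSum c ξ := by
    intro ξ; simp only [signSum, Finset.mul_sum]
    exact Finset.sum_congr rfl fun i _ => by ring
  have hpos : (0 : ℝ) < 2 ^ k / D := by positivity
  simp only [hs, abs_mul, abs_of_pos hpos, mul_pow, ← Finset.mul_sum] at key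
  calc ∑ ξ, max 0 (|signSum c ξ| / (2 ^ k * D) - L)
      ≤ ∑ ξ, Real.exp (2 ^ k / D * |signSum c ξ|) * Real.exp (-(4 ^ k * L)) := by
        refine Finset.sum_le_sum fun ξ _ => ?_
        rw [← Real.exp_add]
        have e : 2 ^ k / D * |signSum c ξ| + -(4 ^ k * L)
            = 4 ^ k * (|signSum c ξ| / (2 ^ k * D) - L) := by
          rw [h4]; field_simp; ring
        rw [e]
        set y := |signSum c ξ| / (2 ^ k * D) - L
        refine max_le (Real.exp_pos _).le ?_
        rcases le_total y 0 with hy | hy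
        · exact hy.trans (Real.exp_pos _).le
        · have := Real.add_one_le_exp (4 ^ k * y)
          nlinarith
    _ = (∑ ξ, Real.exp (2 ^ k / D * |signSum c ξ|)) * Real.exp (-(4 ^ k * L)) := by
        rw [Finset.sum_mul]
    _ ≤ (2 * 2 ^ m * Real.exp ((4 : ℝ) ^ k / 2)) * Real.exp (-(4 ^ k * L)) := by
        refine mul_le_mul_of_nonneg_right (key.trans ?_) (Real.exp_pos _).le
        gcongr
        calc (2 ^ k / D) ^ 2 * ∑ i, c i ^ 2 ≤ (2 ^ k / D) ^ 2 * D ^ 2 := by gcongr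
          _ = 4 ^ k := by rw [h4]; field_simp
    _ = _ := by
        rw [mul_assoc, ← Real.exp_add]; congr 2; ring

/-- Generic chaining for a Rademacher process `x ↦ ∑ i, ξ i * c x i` along nested partitions into
the level sets of `ℓ k`; the conclusion bounds the expectation of the process at an arbitrary
sign-dependent point. -/
theorem sum_signSum_selection_le {α β : Type*} [DecidableEq α] [DecidableEq β] {m : ℕ}
    (c : α → Fin m → ℝ) (T : Finset α) (ℓ : ℕ → α → β) (D : ℕ → α → ℝ) {b W : ℝ} (hb : 0 ≤ b)
    (hDpos : ∀ k, ∀ x ∈ T, 0 < D k x)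
    (h0 : ∀ x ∈ T, ∀ y ∈ T, ℓ 0 x = ℓ 0 y)
    (hnest : ∀ k, ∀ x ∈ T, ∀ y ∈ T, ℓ (k + 1) x = ℓ (k + 1) y → ℓ k x = ℓ k y)
    (hcard : ∀ k, ((T.image (ℓ k)).card : ℝ) ≤ Real.exp (b * 4 ^ k))
    (hDeq : ∀ k, ∀ x ∈ T, ∀ y ∈ T, ℓ k x = ℓ k y → D k x = D k y)
    (hD : ∀ k, ∀ x ∈ T, ∀ y ∈ T, ℓ k x = ℓ k y → ∑ i, (c x i - c y i) ^ 2 ≤ D k x ^ 2)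
    (hsum : ∀ x ∈ T, ∀ N, ∑ k ∈ Finset.range N, 2 ^ k * D k x ≤ W)
    (p : (Fin m → Bool) → α) (hp : ∀ ξ, p ξ ∈ T) :
    (∑ ξ, signSum (c (p ξ)) ξ) / 2 ^ m ≤ (4 * b + 7) * W := by
  classical
  -- representatives of the cells
  have hrep : ∀ k, ∃ r : α → α, ∀ x ∈ T, r x ∈ T ∧ ℓ k (r x) = ℓ k x ∧
      ∀ y ∈ T, ℓ k y = ℓ k x → r y = r x := by
    intro k
    have h : ∀ l : β, ∃ v : α, (∃ x ∈ T, ℓ k x = l) → v ∈ T ∧ ℓ k v = l := by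
      intro l
      by_cases hl : ∃ x ∈ T, ℓ k x = l
      · obtain ⟨x, hx, hxl⟩ := hl
        exact ⟨x, fun _ => ⟨hx, hxl⟩⟩
      · exact ⟨p fun _ => true, fun h => absurd h hl⟩
    choose v hv using h
    refine ⟨fun x => v (ℓ k x), fun x hx => ⟨(hv _ ⟨x, hx, rfl⟩).1, (hv _ ⟨x, hx, rfl⟩).2, ?_⟩⟩
    intro y _ hyx
    simp only [hyx]
  choose r hrT hrℓ hreq using hrep
  set L : ℝ := 4 * b + 2 with hL
  obtain ⟨N, hN⟩ : ∃ N : ℕ, √(m : ℝ) ≤ 2 ^ N := by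
    obtain ⟨N, hN⟩ := pow_unbounded_of_one_lt (√(m : ℝ)) (by norm_num : (1 : ℝ) < 2)
    exact ⟨N, hN.le⟩
  set x₀ := r 0 (p fun _ => true) with hx₀
  have hr0 : ∀ x ∈ T, r 0 x = x₀ := fun x hx =>
    hreq 0 _ (hp _) x hx (h0 x hx _ (hp _))
  set V : ℕ → Finset α := fun k => T.image (r (k + 1)) with hV
  set Y : ℕ → α → (Fin m → Bool) → ℝ := fun k v ξ =>
    max 0 (|signSum (fun i => c v i - c (r k v) i) ξ| / (2 ^ k * D k v) - L) with hY
  have hY0 : ∀ k v ξ, 0 ≤ Y k v ξ := fun k v ξ => le_max_left _ _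
  have hVT : ∀ k, ∀ v ∈ V k, v ∈ T := by
    intro k v hv
    obtain ⟨x, hx, rfl⟩ := Finset.mem_image.1 hv
    exact hrT _ x hx
  have hVcard : ∀ k, ((V k).card : ℝ) ≤ Real.exp (b * 4 ^ (k + 1)) := by
    intro k
    refine le_trans ?_ (hcard (k + 1))
    norm_cast
    refine Finset.card_le_card_of_injOn (ℓ (k + 1)) ?_ ?_
    · intro v hv
      exact Finset.mem_image_of_mem _ (hVT k v hv)
    · intro v hv w hw hvw
      obtain ⟨x, hx, rfl⟩ := Finset.mem_image.1 hv
      obtain ⟨y, hy, rfl⟩ := Finset.mem_image.1 hw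
      simp only [hrℓ _ x hx, hrℓ _ y hy] at hvw
      exact hreq _ y hy x hx hvw
  have hW : 0 ≤ W := by simpa using hsum _ (hp fun _ => true) 0
  -- pointwise bound
  have hpt : ∀ ξ, ∀ x ∈ T, signSum (c x) ξ ≤ signSum (c x₀) ξ
      + W * (L + ∑ k ∈ Finset.range N, ∑ v ∈ V k, Y k v ξ) + W := by
    intro ξ x hx
    have hstep : ∀ k, signSum (c (r (k + 1) x)) ξ - signSum (c (r k x)) ξ
        ≤ 2 ^ k * D k x * (L + ∑ v ∈ V k, Y k v ξ) := by
      intro k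
      set v := r (k + 1) x with hv
      have hvT : v ∈ T := hrT _ x hx
      have hvV : v ∈ V k := Finset.mem_image_of_mem _ hx
      have hvℓ : ℓ k v = ℓ k x := hnest k v hvT x hx (hrℓ _ x hx)
      have hrv : r k x = r k v := (hreq k x hx v hvT hvℓ).symm
      have hDv : D k v = D k x := hDeq k v hvT x hx hvℓ
      have hpos : 0 < 2 ^ k * D k x := mul_pos (by positivity) (hDpos k x hx)
      have h1 : |signSum (fun i => c v i - c (r k v) i) ξ| / (2 ^ k * D k v) ≤ L + Y k v ξ := by
        have := le_max_right 0 (|signSum (fun i => c v i - c (r k v) i) ξ| / (2 ^ k * D k v) - L)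
        simp only [hY]; linarith
      have h2 : Y k v ξ ≤ ∑ v ∈ V k, Y k v ξ :=
        Finset.single_le_sum (f := fun v => Y k v ξ) (fun v _ => hY0 k v ξ) hvV
      rw [hrv, ← signSum_sub]
      refine (le_abs_self _).trans ?_
      rw [hDv, div_le_iff₀ hpos] at h1
      nlinarith
    have htel : signSum (c (r N x)) ξ - signSum (c (r 0 x)) ξ
        ≤ ∑ k ∈ Finset.range N, 2 ^ k * D k x * (L + ∑ v ∈ V k, Y k v ξ) := by
      rw [← Finset.sum_range_sub (fun k => signSum (c (r k x)) ξ)]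
      exact Finset.sum_le_sum fun k _ => hstep k
    have hbig : ∑ k ∈ Finset.range N, 2 ^ k * D k x * (L + ∑ v ∈ V k, Y k v ξ)
        ≤ W * (L + ∑ k ∈ Finset.range N, ∑ v ∈ V k, Y k v ξ) := by
      have hle : ∀ k ∈ Finset.range N, L + ∑ v ∈ V k, Y k v ξ
          ≤ L + ∑ k ∈ Finset.range N, ∑ v ∈ V k, Y k v ξ := by
        intro k hk
        have := Finset.single_le_sum (f := fun k => ∑ v ∈ V k, Y k v ξ)
          (fun k _ => Finset.sum_nonneg fun v _ => hY0 k v ξ) hk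
        simpa using this
      have hnn : 0 ≤ L + ∑ k ∈ Finset.range N, ∑ v ∈ V k, Y k v ξ := by
        have : 0 ≤ ∑ k ∈ Finset.range N, ∑ v ∈ V k, Y k v ξ :=
          Finset.sum_nonneg fun k _ => Finset.sum_nonneg fun v _ => hY0 k v ξ
        rw [hL]; linarith
      calc _ ≤ ∑ k ∈ Finset.range N, 2 ^ k * D k x
              * (L + ∑ k ∈ Finset.range N, ∑ v ∈ V k, Y k v ξ) := by
            refine Finset.sum_le_sum fun k hk => ?_
            exact mul_le_mul_of_nonneg_left (hle k hk)
              (mul_nonneg (by positivity) (hDpos k x hx).le)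
        _ ≤ _ := by
            rw [← Finset.sum_mul]
            exact mul_le_mul_of_nonneg_right (hsum x hx N) hnn
    have hlast : signSum (c x) ξ - signSum (c (r N x)) ξ ≤ W := by
      rw [← signSum_sub]
      refine (le_abs_self _).trans ((abs_signSum_le _ ξ).trans ?_)
      have h1 : √(∑ i, (c x i - c (r N x) i) ^ 2) ≤ D N x := by
        refine Real.sqrt_le_iff.2 ⟨(hDpos N x hx).le, ?_⟩
        exact hD N x hx _ (hrT _ x hx) (hrℓ _ x hx).symm
      have h2 : 2 ^ N * D N x ≤ W := by
        refine le_trans ?_ (hsum x hx (N + 1))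
        exact Finset.single_le_sum (f := fun k => 2 ^ k * D k x)
          (fun k _ => mul_nonneg (by positivity) (hDpos k x hx).le) (by simp)
      exact (mul_le_mul hN h1 (Real.sqrt_nonneg _) (by positivity)).trans h2
    rw [hr0 x hx] at htel
    linarith
  -- averaging
  have hYsum : ∀ k, ∑ ξ, ∑ v ∈ V k, Y k v ξ ≤ 2 * 2 ^ m * (1 / 2) ^ (k + 1) := by
    intro k
    rw [Finset.sum_comm]
    have hv : ∀ v ∈ V k, ∑ ξ, Y k v ξ ≤ 2 * 2 ^ m * Real.exp (4 ^ k * (1 / 2 - L)) := by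
      intro v hv
      have hvT := hVT k v hv
      exact sum_max_signSum_sub_le _ (hDpos k v hvT)
        (hD k v hvT _ (hrT _ v hvT) (hrℓ _ v hvT).symm) k L
    calc _ ≤ (V k).card • (2 * 2 ^ m * Real.exp (4 ^ k * (1 / 2 - L))) :=
          Finset.sum_le_card_nsmul _ _ _ hv
      _ ≤ Real.exp (b * 4 ^ (k + 1)) * (2 * 2 ^ m * Real.exp (4 ^ k * (1 / 2 - L))) := by
          rw [nsmul_eq_mul]
          exact mul_le_mul_of_nonneg_right (hVcard k) (by positivity)
      _ = 2 * 2 ^ m * Real.exp (-(3 / 2) * 4 ^ k) := by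
          have : Real.exp (-(3 / 2) * 4 ^ k)
              = Real.exp (b * 4 ^ (k + 1)) * Real.exp (4 ^ k * (1 / 2 - L)) := by
            rw [← Real.exp_add]; congr 1; rw [hL]; ring
          rw [this]; ring
      _ ≤ _ := by
          refine mul_le_mul_of_nonneg_left ?_ (by positivity)
          have h1 : ((k + 1 : ℕ) : ℝ) ≤ 4 ^ k := by
            have : k + 1 ≤ 4 ^ k := (Nat.lt_pow_self (by norm_num : 1 < 4))
            exact_mod_cast this
          calc Real.exp (-(3 / 2) * 4 ^ k) ≤ Real.exp (((k + 1 : ℕ) : ℝ) * (-1)) := by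
                apply Real.exp_le_exp.2
                have : (0 : ℝ) < 4 ^ k := by positivity
                linarith
            _ = Real.exp (-1) ^ (k + 1) := Real.exp_nat_mul _ _
            _ ≤ (1 / 2) ^ (k + 1) := by
                gcongr
                rw [Real.exp_neg, one_div]
                gcongr
                have := Real.add_one_le_exp 1
                linarith
  have hgeo : ∑ k ∈ Finset.range N, ((1 : ℝ) / 2) ^ (k + 1) ≤ 1 := by
    have : ∀ N : ℕ, ∑ k ∈ Finset.range N, ((1 : ℝ) / 2) ^ (k + 1) = 1 - (1 / 2) ^ N := by
      intro N
      induction N with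
      | zero => simp
      | succ N ih => rw [Finset.sum_range_succ, ih]; ring
    rw [this]
    have : (0 : ℝ) ≤ (1 / 2) ^ N := by positivity
    linarith
  have htot : ∑ ξ, signSum (c (p ξ)) ξ
      ≤ ∑ ξ, (signSum (c x₀) ξ + W * (L + ∑ k ∈ Finset.range N, ∑ v ∈ V k, Y k v ξ) + W) :=
    Finset.sum_le_sum fun ξ _ => hpt ξ (p ξ) (hp ξ)
  have hcomm : ∑ ξ, ∑ k ∈ Finset.range N, ∑ v ∈ V k, Y k v ξ ≤ 2 * 2 ^ m := by
    rw [Finset.sum_comm]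
    calc _ ≤ ∑ k ∈ Finset.range N, 2 * 2 ^ m * ((1 : ℝ) / 2) ^ (k + 1) :=
          Finset.sum_le_sum fun k _ => hYsum k
      _ = 2 * 2 ^ m * ∑ k ∈ Finset.range N, ((1 : ℝ) / 2) ^ (k + 1) := by rw [Finset.mul_sum]
      _ ≤ 2 * 2 ^ m * 1 := by gcongr
      _ = _ := by ring
  rw [Finset.sum_add_distrib, Finset.sum_add_distrib, sum_signSum, ← Finset.mul_sum,
    Finset.sum_add_distrib] at htot
  simp only [Finset.sum_const, Finset.card_univ, Fintype.card_fun, Fintype.card_bool,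
    Fintype.card_fin, nsmul_eq_mul, Nat.cast_pow, Nat.cast_ofNat] at htot
  rw [div_le_iff₀ (by positivity)]
  have : W * ∑ ξ, ∑ k ∈ Finset.range N, ∑ v ∈ V k, Y k v ξ ≤ W * (2 * 2 ^ m) :=
    mul_le_mul_of_nonneg_left hcomm hW
  have hpow : (0 : ℝ) ≤ W * 2 ^ m := by positivity
  rw [hL] at htot
  nlinarith

section Gaussian

open MeasureTheory

/-- The unnormalised standard Gaussian density on `ℝⁿ`. -/
noncomputable def gaussWeight {n : ℕ} (x : Fin n → ℝ) : ℝ := Real.exp (-(∑ i, x i ^ 2) / 2)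

lemma gaussWeight_pos {n : ℕ} (x : Fin n → ℝ) : 0 < gaussWeight x := Real.exp_pos _

lemma continuous_gaussWeight {n : ℕ} : Continuous (gaussWeight (n := n)) := by
  unfold gaussWeight; fun_prop

lemma integrable_gaussWeight {n : ℕ} : Integrable (gaussWeight (n := n)) := by
  have h : gaussWeight (n := n) = fun x => ∏ i, Real.exp (-(1 / 2) * x i ^ 2) := by
    funext x
    rw [gaussWeight, ← Real.exp_sum, ← Finset.mul_sum]
    congr 1; ring
  rw [h]
  exact Integrable.fintype_prod (f := fun _ x => Real.exp (-(1 / 2) * x ^ 2))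
    fun _ => integrable_exp_neg_mul_sq (by norm_num)

lemma integral_gaussWeight_pos {n : ℕ} : 0 < ∫ x : Fin n → ℝ, gaussWeight x := by
  rw [integral_pos_iff_support_of_nonneg (fun x => (gaussWeight_pos x).le) integrable_gaussWeight]
  have : Function.support (gaussWeight (n := n)) = Set.univ := by
    ext x; simp [(gaussWeight_pos x).ne']
  rw [this, Measure.measure_univ_pos]
  exact NeZero.ne _

lemma exp_dotProduct_mul_gaussWeight {n : ℕ} (a x : Fin n → ℝ) :
    Real.exp (a ⬝ᵥ x) * gaussWeight x
      = Real.exp ((∑ i, a i ^ 2) / 2) * gaussWeight (x - a) := by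
  rw [gaussWeight, gaussWeight, ← Real.exp_add, ← Real.exp_add]
  congr 1
  have : ∑ i, (x - a) i ^ 2 = ∑ i, x i ^ 2 - 2 * (a ⬝ᵥ x) + ∑ i, a i ^ 2 := by
    simp only [dotProduct, Finset.mul_sum, ← Finset.sum_sub_distrib, ← Finset.sum_add_distrib,
      Pi.sub_apply]
    exact Finset.sum_congr rfl fun i _ => by ring
  rw [this]; ring

lemma integrable_exp_dotProduct {n : ℕ} (a : Fin n → ℝ) :
    Integrable fun x => Real.exp (a ⬝ᵥ x) * gaussWeight x := by
  simp_rw [exp_dotProduct_mul_gaussWeight]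
  exact (integrable_gaussWeight.comp_sub_right a).const_mul _

lemma integral_exp_dotProduct {n : ℕ} (a : Fin n → ℝ) :
    ∫ x, Real.exp (a ⬝ᵥ x) * gaussWeight x
      = Real.exp ((∑ i, a i ^ 2) / 2) * ∫ x : Fin n → ℝ, gaussWeight x := by
  simp_rw [exp_dotProduct_mul_gaussWeight]
  rw [integral_const_mul, integral_sub_right_eq_self (fun x => gaussWeight x) a]

lemma sq_le_exp_of_nonneg {v l : ℝ} (hv : 0 ≤ v) (hl : 0 < l) :
    v ^ 2 ≤ 8 * l ^ 2 + 4 / l ^ 2 * (Real.exp (-2 * l ^ 2) * Real.exp (l * v)) := by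
  rw [← Real.exp_add]
  rcases le_total v (2 * l) with h | h
  · have : 0 ≤ 4 / l ^ 2 * Real.exp (-2 * l ^ 2 + l * v) := by positivity
    nlinarith
  · have h1 : (l * (v - 2 * l)) ^ 2 / 2 ≤ Real.exp (-2 * l ^ 2 + l * v) := by
      have := Real.quadratic_le_exp_of_nonneg
        (show 0 ≤ l * (v - 2 * l) from mul_nonneg hl.le (by linarith))
      have h2 : l * (v - 2 * l) = -2 * l ^ 2 + l * v := by ring
      have h3 : 0 ≤ l * (v - 2 * l) := mul_nonneg hl.le (by linarith)
      rw [← h2]; linarith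
    have h2 : 2 * (v - 2 * l) ^ 2 = 4 / l ^ 2 * ((l * (v - 2 * l)) ^ 2 / 2) := by
      field_simp; ring
    have h3 := mul_le_mul_of_nonneg_left h1 (show 0 ≤ 4 / l ^ 2 by positivity)
    nlinarith [sq_nonneg (v - 4 * l)]

/-- Gaussian second moment of a maximum of `d` linear forms. -/
lemma integral_sq_max_le {n : ℕ} {ι : Type*} (S : Finset ι) (a : ι → Fin n → ℝ) {M d : ℝ}
    (hM : 0 < M) (ha : ∀ j ∈ S, ∑ i, a j i ^ 2 ≤ M ^ 2) (hd : 2 ≤ d) (hS : (S.card : ℝ) ≤ d)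
    (F : (Fin n → ℝ) → ℝ) (hF : Continuous F) (hF0 : ∀ x, 0 ≤ F x)
    (hFS : ∀ x, ∃ j ∈ S, F x ≤ |a j ⬝ᵥ x|) :
    Integrable (fun x => F x ^ 2 * gaussWeight x) ∧
      ∫ x, F x ^ 2 * gaussWeight x
        ≤ 32 * M ^ 2 * Real.log d * ∫ x : Fin n → ℝ, gaussWeight x := by
  set G := ∫ x : Fin n → ℝ, gaussWeight x with hG
  have hGpos : 0 < G := integral_gaussWeight_pos
  have hlog2 : (0.69 : ℝ) ≤ Real.log d := by
    have := Real.log_two_gt_d9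
    have := Real.log_le_log (by norm_num) hd
    linarith
  set l := √(Real.log d) with hl
  have hl2 : l ^ 2 = Real.log d := Real.sq_sqrt (by linarith)
  have hlpos : 0 < l := Real.sqrt_pos.2 (by linarith)
  set B : (Fin n → ℝ) → ℝ := fun x => M ^ 2 * (8 * l ^ 2 * gaussWeight x
    + 4 / l ^ 2 * Real.exp (-2 * l ^ 2) *
      ∑ j ∈ S, (Real.exp (((l / M) • a j) ⬝ᵥ x) * gaussWeight x
        + Real.exp ((-(l / M) • a j) ⬝ᵥ x) * gaussWeight x)) with hB
  have hbound : ∀ x, F x ^ 2 * gaussWeight x ≤ B x := by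
    intro x
    obtain ⟨j, hj, hFj⟩ := hFS x
    have h1 := sq_le_exp_of_nonneg (v := F x / M) (div_nonneg (hF0 x) hM.le) hlpos
    have h2 : Real.exp (l * (F x / M)) ≤
        ∑ j ∈ S, (Real.exp (((l / M) • a j) ⬝ᵥ x) + Real.exp ((-(l / M) • a j) ⬝ᵥ x)) := by
      have h3 : Real.exp (l * (F x / M)) ≤
          Real.exp (((l / M) • a j) ⬝ᵥ x) + Real.exp ((-(l / M) • a j) ⬝ᵥ x) := by
        have h4 : l * (F x / M) ≤ (l / M) * |a j ⬝ᵥ x| := by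
          rw [mul_div_assoc', div_mul_eq_mul_div]; gcongr
        refine (Real.exp_le_exp.2 h4).trans ?_
        simp only [smul_dotProduct, smul_eq_mul]
        rcases abs_cases (a j ⬝ᵥ x) with h | h <;> rw [h.1]
        · linarith [Real.exp_pos (-(l / M) * (a j ⬝ᵥ x))]
        · rw [mul_neg, ← neg_mul]; linarith [Real.exp_pos (l / M * (a j ⬝ᵥ x))]
      exact h3.trans (Finset.single_le_sum
        (f := fun j => Real.exp (((l / M) • a j) ⬝ᵥ x) + Real.exp ((-(l / M) • a j) ⬝ᵥ x))
        (fun j _ => by positivity) hj)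
    have h5 : F x ^ 2 = M ^ 2 * (F x / M) ^ 2 := by field_simp
    have hw := gaussWeight_pos x
    rw [h5]
    have h6 : B x = M ^ 2 * (8 * l ^ 2 + 4 / l ^ 2 * (Real.exp (-2 * l ^ 2) *
        ∑ j ∈ S, (Real.exp (((l / M) • a j) ⬝ᵥ x) + Real.exp ((-(l / M) • a j) ⬝ᵥ x))))
          * gaussWeight x := by
      simp only [hB, ← add_mul, ← Finset.sum_mul]; ring
    rw [h6]
    gcongr
    exact h1.trans (by gcongr)
  have hBint : Integrable B := by
    refine Integrable.const_mul (Integrable.add (integrable_gaussWeight.const_mul _)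
      (Integrable.const_mul (integrable_finsetSum _ fun j _ => ?_) _)) _
    exact (integrable_exp_dotProduct _).add (integrable_exp_dotProduct _)
  have hFint : Integrable (fun x => F x ^ 2 * gaussWeight x) := by
    refine hBint.mono' ((hF.pow 2).mul continuous_gaussWeight).aestronglyMeasurable
      (Filter.Eventually.of_forall fun x => ?_)
    rw [Real.norm_of_nonneg (mul_nonneg (sq_nonneg _) (gaussWeight_pos x).le)]
    exact hbound x
  refine ⟨hFint, (integral_mono hFint hBint hbound).trans ?_⟩
  have hsum : ∫ x, ∑ j ∈ S, (Real.exp (((l / M) • a j) ⬝ᵥ x) * gaussWeight x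
      + Real.exp ((-(l / M) • a j) ⬝ᵥ x) * gaussWeight x)
      ≤ d * (2 * Real.exp (l ^ 2 / 2) * G) := by
    have hint : ∀ j ∈ S, Integrable fun x => Real.exp (((l / M) • a j) ⬝ᵥ x) * gaussWeight x
        + Real.exp ((-(l / M) • a j) ⬝ᵥ x) * gaussWeight x := fun j _ =>
      (integrable_exp_dotProduct _).add (integrable_exp_dotProduct _)
    rw [integral_finsetSum _ hint]
    calc _ ≤ S.card • (2 * Real.exp (l ^ 2 / 2) * G) := by
          refine Finset.sum_le_card_nsmul _ _ _ fun j hj => ?_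
          rw [integral_add (integrable_exp_dotProduct _) (integrable_exp_dotProduct _),
            integral_exp_dotProduct, integral_exp_dotProduct, ← hG]
          have : ∑ i, ((l / M) • a j) i ^ 2 ≤ l ^ 2 := by
            simp only [Pi.smul_apply, smul_eq_mul, mul_pow, ← Finset.mul_sum]
            calc _ ≤ (l / M) ^ 2 * M ^ 2 := by gcongr; exact ha j hj
              _ = l ^ 2 := by field_simp
          have h2 : ∑ i, (-(l / M) • a j) i ^ 2 = ∑ i, ((l / M) • a j) i ^ 2 := by simp
          rw [h2]
          have h3 : Real.exp ((∑ i, ((l / M) • a j) i ^ 2) / 2) ≤ Real.exp (l ^ 2 / 2) := by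
            gcongr
          nlinarith
      _ ≤ _ := by
          rw [nsmul_eq_mul]; gcongr
  have hBI : ∫ x, B x = M ^ 2 * (8 * l ^ 2 * G + 4 / l ^ 2 * Real.exp (-2 * l ^ 2) *
      ∫ x, ∑ j ∈ S, (Real.exp (((l / M) • a j) ⬝ᵥ x) * gaussWeight x
      + Real.exp ((-(l / M) • a j) ⬝ᵥ x) * gaussWeight x)) := by
    rw [hB, integral_const_mul, integral_add (integrable_gaussWeight.const_mul _),
      integral_const_mul, integral_const_mul]
    refine Integrable.const_mul (integrable_finsetSum _ fun j _ => ?_) _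
    exact (integrable_exp_dotProduct _).add (integrable_exp_dotProduct _)
  rw [hBI]
  have hdexp : d = Real.exp (l ^ 2) := by rw [hl2, Real.exp_log (by linarith)]
  have hfin : 4 / l ^ 2 * Real.exp (-2 * l ^ 2) * (d * (2 * Real.exp (l ^ 2 / 2) * G))
      ≤ 24 * l ^ 2 * G := by
    have h1 : Real.exp (-2 * l ^ 2) * d * Real.exp (l ^ 2 / 2) ≤ 1 := by
      rw [hdexp, ← Real.exp_add, ← Real.exp_add, Real.exp_le_one_iff]
      nlinarith
    have h2 : 8 / l ^ 2 ≤ 24 * l ^ 2 := by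
      rw [div_le_iff₀ (by positivity)]; rw [hl2]; nlinarith
    calc _ = 8 / l ^ 2 * (Real.exp (-2 * l ^ 2) * d * Real.exp (l ^ 2 / 2)) * G := by ring
      _ ≤ 8 / l ^ 2 * 1 * G := by gcongr
      _ ≤ _ := by rw [mul_one]; gcongr
  calc _ ≤ M ^ 2 * (8 * l ^ 2 * G + 4 / l ^ 2 * Real.exp (-2 * l ^ 2) *
        (d * (2 * Real.exp (l ^ 2 / 2) * G))) := by gcongr
    _ ≤ M ^ 2 * (8 * l ^ 2 * G + 24 * l ^ 2 * G) := by gcongr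
    _ = _ := by rw [hl2]; ring

/-- Dual Sudakov packing bound: points of the Euclidean ball of radius `R` that are separated with
respect to a quadratic quasi-norm `Q` of Gaussian mean at most `1`. -/
lemma card_packing_le {n : ℕ} (Q : (Fin n → ℝ) → ℝ) (hQc : Continuous Q) (hQ0 : ∀ x, 0 ≤ Q x)
    (hQsub : ∀ x y, Q (x - y) ≤ 2 * Q x + 2 * Q y) (hQsmul : ∀ (c : ℝ) x, Q (c • x) = c ^ 2 * Q x)
    (hQint : Integrable fun x => Q x * gaussWeight x)
    (hQle : ∫ x, Q x * gaussWeight x ≤ ∫ x : Fin n → ℝ, gaussWeight x)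
    {δ R : ℝ} (hδ : 0 < δ) (hδ1 : δ ≤ 1) (P : Finset (Fin n → ℝ))
    (hPR : ∀ x ∈ P, ∑ i, x i ^ 2 ≤ R ^ 2)
    (hPsep : ∀ x ∈ P, ∀ y ∈ P, x ≠ y → 8 * δ ^ 2 < Q (x - y)) :
    (P.card : ℝ) ≤ 2 * δ⁻¹ ^ n * Real.exp (R ^ 2 / 2) := by
  classical
  set G := ∫ x : Fin n → ℝ, gaussWeight x with hG
  have hGpos : 0 < G := integral_gaussWeight_pos
  set B : Set (Fin n → ℝ) := {v | Q v ≤ 2} with hB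
  have hBm : MeasurableSet B := (isClosed_le hQc continuous_const).measurableSet
  have hQneg : ∀ v, Q (-v) = Q v := by
    intro v; have := hQsmul (-1) v; simpa using this
  -- mass of the unit ball
  have hBmass : G / 2 ≤ ∫ v, B.indicator gaussWeight v := by
    have h1 : ∫ v, (gaussWeight v - 1 / 2 * (Q v * gaussWeight v)) ≤ ∫ v, B.indicator gaussWeight v := by
      refine integral_mono (integrable_gaussWeight.sub (hQint.const_mul _))
        (integrable_gaussWeight.indicator hBm) fun v => ?_
      have hw := gaussWeight_pos v
      by_cases hv : v ∈ B
      · simp only [Set.indicator_of_mem hv]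
        have := mul_nonneg (hQ0 v) hw.le
        linarith
      · simp only [Set.indicator_of_notMem hv]
        have hv' : 2 < Q v := not_le.1 hv
        nlinarith
    rw [integral_sub integrable_gaussWeight (hQint.const_mul _), integral_const_mul] at h1
    linarith
  -- mass of a translated and dilated ball
  set f : (Fin n → ℝ) → (Fin n → ℝ) → ℝ := fun x u =>
    B.indicator (fun _ => (1 : ℝ)) (δ⁻¹ • (u - x)) * gaussWeight u with hf
  have hsmulm : ∀ x : Fin n → ℝ, Measurable fun u : Fin n → ℝ => δ⁻¹ • (u - x) := fun x => by
    fun_prop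
  have hfint : ∀ x, Integrable (f x) := by
    intro x
    refine integrable_gaussWeight.mono'
      ((((measurable_const.indicator hBm).comp (hsmulm x)).mul
        continuous_gaussWeight.measurable).aestronglyMeasurable)
      (Filter.Eventually.of_forall fun u => ?_)
    have hw := gaussWeight_pos u
    simp only [hf, Set.indicator_apply]
    split_ifs <;> simp [abs_of_pos hw, hw.le]
  have hfmass : ∀ x ∈ P, δ ^ n * (Real.exp (-(R ^ 2) / 2) * (G / 2)) ≤ ∫ u, f x u := by
    intro x hx
    set g : (Fin n → ℝ) → ℝ := fun v => B.indicator (fun _ => (1 : ℝ)) v * gaussWeight (x + δ • v)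
      with hg
    have hfg : ∀ u, f x u = g (δ⁻¹ • (u - x)) := by
      intro u
      simp only [hf, hg, smul_smul, mul_inv_cancel₀ hδ.ne', one_smul, add_sub_cancel]
    have hcv : ∫ u, f x u = δ ^ n * ∫ v, g v := by
      simp_rw [hfg]
      rw [integral_sub_right_eq_self (fun u => g (δ⁻¹ • u)) x, Measure.integral_comp_smul]
      simp [abs_of_pos hδ]
    have hgint : Integrable g := by
      have h1 : Integrable fun v : Fin n → ℝ => gaussWeight (x + δ • v) :=
        (integrable_gaussWeight.comp_add_left x).comp_smul hδ.ne'
      refine h1.mono' (((measurable_const.indicator hBm).mul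
        (continuous_gaussWeight.comp (by fun_prop)).measurable).aestronglyMeasurable)
        (Filter.Eventually.of_forall fun u => ?_)
      have hw := gaussWeight_pos (x + δ • u)
      simp only [hg, Set.indicator_apply]
      split_ifs <;> simp [abs_of_pos hw, hw.le]
    have hgneg : ∫ v, g (-v) = ∫ v, g v := integral_neg_eq_self g _
    have hpt : ∀ v, 2 * Real.exp (-(R ^ 2) / 2) * B.indicator gaussWeight v ≤ g v + g (-v) := by
      intro v
      have hmem : -v ∈ B ↔ v ∈ B := by simp only [hB, Set.mem_ofPred_eq, hQneg]
      by_cases hv : v ∈ B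
      · simp only [hg, Set.indicator_of_mem hv, Set.indicator_of_mem (hmem.2 hv), one_mul]
        set s := x ⬝ᵥ v
        have e1 : gaussWeight (x + δ • v)
            = Real.exp (-(∑ i, x i ^ 2 + δ ^ 2 * ∑ i, v i ^ 2) / 2) * Real.exp (-(δ * s)) := by
          rw [gaussWeight, ← Real.exp_add]; congr 1
          have : ∑ i, (x + δ • v) i ^ 2
              = ∑ i, x i ^ 2 + δ ^ 2 * ∑ i, v i ^ 2 + 2 * (δ * s) := by
            simp only [s, dotProduct, Finset.mul_sum, ← Finset.sum_add_distrib, Pi.add_apply,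
              Pi.smul_apply, smul_eq_mul]
            exact Finset.sum_congr rfl fun i _ => by ring
          rw [this]; ring
        have e2 : gaussWeight (x + δ • -v)
            = Real.exp (-(∑ i, x i ^ 2 + δ ^ 2 * ∑ i, v i ^ 2) / 2) * Real.exp (δ * s) := by
          rw [gaussWeight, ← Real.exp_add]; congr 1
          have : ∑ i, (x + δ • -v) i ^ 2
              = ∑ i, x i ^ 2 + δ ^ 2 * ∑ i, v i ^ 2 - 2 * (δ * s) := by
            simp only [s, dotProduct, Finset.mul_sum, ← Finset.sum_add_distrib, Pi.add_apply,
              Pi.smul_apply, smul_eq_mul, ← Finset.sum_sub_distrib, Pi.neg_apply]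
            exact Finset.sum_congr rfl fun i _ => by ring
          rw [this]; ring
        have e3 : Real.exp (-(R ^ 2) / 2) * gaussWeight v
            ≤ Real.exp (-(∑ i, x i ^ 2 + δ ^ 2 * ∑ i, v i ^ 2) / 2) := by
          rw [gaussWeight, ← Real.exp_add]
          apply Real.exp_le_exp.2
          have h1 := hPR x hx
          have h2 : 0 ≤ ∑ i, v i ^ 2 := Finset.sum_nonneg fun i _ => sq_nonneg _
          have h3 : δ ^ 2 ≤ 1 := pow_le_one₀ hδ.le hδ1
          nlinarith
        have e4 : 2 ≤ Real.exp (-(δ * s)) + Real.exp (δ * s) := by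
          linarith [Real.add_one_le_exp (-(δ * s)), Real.add_one_le_exp (δ * s)]
        rw [e1, e2]
        have := Real.exp_pos (-(∑ i, x i ^ 2 + δ ^ 2 * ∑ i, v i ^ 2) / 2)
        nlinarith
      · simp [hg, Set.indicator_of_notMem hv, Set.indicator_of_notMem (mt hmem.1 hv)]
    have hI := integral_mono ((integrable_gaussWeight.indicator hBm).const_mul
      (2 * Real.exp (-(R ^ 2) / 2))) (hgint.add hgint.comp_neg) hpt
    simp only [Pi.add_apply] at hI
    rw [integral_const_mul, integral_add hgint hgint.comp_neg, hgneg] at hI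
    rw [hcv]
    have hE := Real.exp_pos (-(R ^ 2) / 2)
    gcongr
    nlinarith
  -- disjointness
  have hdisj : ∀ u, ∑ x ∈ P, f x u ≤ gaussWeight u := by
    intro u
    simp only [hf, ← Finset.sum_mul]
    refine mul_le_of_le_one_left (gaussWeight_pos u).le ?_
    simp only [Set.indicator_apply]
    rw [Finset.sum_boole]
    norm_cast
    rw [Finset.card_le_one]
    intro x hx y hy
    simp only [Finset.mem_filter, hB, Set.mem_ofPred_eq, hQsmul, inv_pow] at hx hy
    by_contra hxy
    have h1 := hPsep x hx.1 y hy.1 hxy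
    have h2 := hQsub (u - y) (u - x)
    rw [sub_sub_sub_cancel_left] at h2
    have h3 := hx.2
    have h4 := hy.2
    rw [inv_mul_le_iff₀ (by positivity)] at h3 h4
    linarith
  have hfinal : (P.card : ℝ) * (δ ^ n * (Real.exp (-(R ^ 2) / 2) * (G / 2))) ≤ G := by
    calc _ = ∑ _x ∈ P, δ ^ n * (Real.exp (-(R ^ 2) / 2) * (G / 2)) := by simp
      _ ≤ ∑ x ∈ P, ∫ u, f x u := Finset.sum_le_sum hfmass
      _ = ∫ u, ∑ x ∈ P, f x u := (integral_finsetSum _ fun x _ => hfint x).symm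
      _ ≤ G := integral_mono (integrable_finsetSum _ fun x _ => hfint x)
          integrable_gaussWeight hdisj
  have e : Real.exp (-(R ^ 2) / 2) = (Real.exp (R ^ 2 / 2))⁻¹ := by
    rw [← Real.exp_neg]; congr 1; ring
  rw [e] at hfinal
  have hE := Real.exp_pos (R ^ 2 / 2)
  have hδn : 0 < δ ^ n := by positivity
  have h6 : (P.card : ℝ) * (δ ^ n * ((Real.exp (R ^ 2 / 2))⁻¹ * (G / 2)))
      = G * (P.card / (2 * δ⁻¹ ^ n * Real.exp (R ^ 2 / 2))) := by
    rw [inv_pow]; field_simp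
  rw [h6] at hfinal
  have h7 := le_of_mul_le_mul_left (hfinal.trans_eq (mul_one G).symm) hGpos
  rwa [div_le_one (by positivity)] at h7

end Gaussian

section Geometry

variable {n m : ℕ}

/-- A quasi-metric dominating the increments of `∑ i, ξ i * φ i x ^ 2`. -/
noncomputable def chainDist (φ : Fin m → Seminorm ℝ (Fin n → ℝ)) (x y : Fin n → ℝ) : ℝ :=
  √(∑ i, (φ i (x - y) * (φ i x + φ i y)) ^ 2)

/-- A functional which is uniformly convex both in `x` and in `(φ i x)ᵢ`. -/
noncomputable def chainEnergy (φ : Fin m → Seminorm ℝ (Fin n → ℝ)) (K : ℝ) (x : Fin n → ℝ) : ℝ :=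
  ∑ j, x j ^ 2 + (∑ i, φ i x ^ 2) / K ^ 2

variable (φ : Fin m → Seminorm ℝ (Fin n → ℝ))

lemma chainDist_nonneg (x y : Fin n → ℝ) : 0 ≤ chainDist φ x y := Real.sqrt_nonneg _

lemma sq_chainDist (x y : Fin n → ℝ) :
    chainDist φ x y ^ 2 = ∑ i, (φ i (x - y) * (φ i x + φ i y)) ^ 2 :=
  Real.sq_sqrt (Finset.sum_nonneg fun _ _ => sq_nonneg _)

lemma chainDist_comm (x y : Fin n → ℝ) : chainDist φ x y = chainDist φ y x := by
  unfold chainDist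
  congr 1
  refine Finset.sum_congr rfl fun i _ => ?_
  rw [map_sub_rev, add_comm]

lemma seminorm_sub_mul_add_le (p : Seminorm ℝ (Fin n → ℝ)) (x w y : Fin n → ℝ) :
    (p (x - y) * (p x + p y)) ^ 2
      ≤ 16 * ((p (x - w) * (p x + p w)) ^ 2 + (p (w - y) * (p w + p y)) ^ 2) := by
  have h1 : p (x - y) ≤ p (x - w) + p (w - y) := by
    have := map_add_le_add p (x - w) (w - y); rwa [sub_add_sub_cancel] at this
  have hx : p x ≤ p w + p (x - w) := by
    have := map_add_le_add p w (x - w); rwa [add_sub_cancel] at this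
  have hy : p y ≤ p w + p (w - y) := by
    have := map_add_le_add p w (y - w); rwa [add_sub_cancel, map_sub_rev] at this
  have hxw := map_sub_le_add p x w
  have hwy := map_sub_le_add p w y
  have n1 := apply_nonneg p x
  have n2 := apply_nonneg p w
  have n3 := apply_nonneg p y
  have n4 := apply_nonneg p (x - y)
  have n5 := apply_nonneg p (x - w)
  have n6 := apply_nonneg p (w - y)
  rcases le_total (p (w - y)) (p (x - w)) with h | h
  · have : p (x - y) * (p x + p y) ≤ 2 * p (x - w) * (2 * (p x + p w)) :=
      mul_le_mul (by linarith) (by linarith) (by linarith) (by linarith)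
    have := pow_le_pow_left₀ (by positivity) this 2
    nlinarith [sq_nonneg (p (w - y) * (p w + p y))]
  · have : p (x - y) * (p x + p y) ≤ 2 * p (w - y) * (2 * (p w + p y)) :=
      mul_le_mul (by linarith) (by linarith) (by linarith) (by linarith)
    have := pow_le_pow_left₀ (by positivity) this 2
    nlinarith [sq_nonneg (p (x - w) * (p x + p w))]

lemma chainDist_triangle (x w y : Fin n → ℝ) :
    chainDist φ x y ≤ 4 * (chainDist φ x w + chainDist φ w y) := by
  have h0 := chainDist_nonneg φ x w
  have h1 := chainDist_nonneg φ w y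
  refine Real.sqrt_le_iff.2 ⟨by positivity, ?_⟩
  have : ∑ i, (φ i (x - y) * (φ i x + φ i y)) ^ 2
      ≤ 16 * (chainDist φ x w ^ 2 + chainDist φ w y ^ 2) := by
    rw [sq_chainDist, sq_chainDist, ← Finset.sum_add_distrib, Finset.mul_sum]
    exact Finset.sum_le_sum fun i _ => seminorm_sub_mul_add_le (φ i) x w y
  nlinarith [mul_nonneg h0 h1]

lemma seminorm_midpoint_le (p : Seminorm ℝ (Fin n → ℝ)) (x y : Fin n → ℝ) :
    p ((1 / 2 : ℝ) • (x + y)) ≤ (p x + p y) / 2 := by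
  rw [map_smul_eq_mul]
  have := map_add_le_add p x y
  norm_num
  linarith

lemma chainDist_midpoint_le (x y : Fin n → ℝ) :
    chainDist φ x ((1 / 2 : ℝ) • (x + y)) ≤ chainDist φ x y := by
  refine Real.sqrt_le_sqrt (Finset.sum_le_sum fun i _ => ?_)
  have h1 := seminorm_midpoint_le (φ i) x y
  have h2 : φ i (x - (1 / 2 : ℝ) • (x + y)) = φ i (x - y) / 2 := by
    have : x - (1 / 2 : ℝ) • (x + y) = (1 / 2 : ℝ) • (x - y) := by
      ext j; simp; ring
    rw [this, map_smul_eq_mul]; norm_num; ring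
  rw [h2]
  have n1 := apply_nonneg (φ i) x
  have n2 := apply_nonneg (φ i) y
  have n3 := apply_nonneg (φ i) (x - y)
  have n4 := apply_nonneg (φ i) ((1 / 2 : ℝ) • (x + y))
  refine pow_le_pow_left₀ (by positivity) ?_ 2
  calc φ i (x - y) / 2 * (φ i x + φ i ((1 / 2 : ℝ) • (x + y)))
      ≤ φ i (x - y) / 2 * (2 * (φ i x + φ i y)) := by gcongr; linarith
    _ = _ := by ring

lemma chainEnergy_nonneg (K : ℝ) (x : Fin n → ℝ) : 0 ≤ chainEnergy φ K x := by
  unfold chainEnergy; positivity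

lemma chainEnergy_midpoint_le (K : ℝ) (x y : Fin n → ℝ) :
    chainEnergy φ K ((1 / 2 : ℝ) • (x + y)) + (∑ j, (x - y) j ^ 2) / 4
        + (∑ i, (φ i x - φ i y) ^ 2) / K ^ 2 / 4
      ≤ (chainEnergy φ K x + chainEnergy φ K y) / 2 := by
  have h1 : ∑ j, ((1 / 2 : ℝ) • (x + y)) j ^ 2 + (∑ j, (x - y) j ^ 2) / 4
      = (∑ j, x j ^ 2 + ∑ j, y j ^ 2) / 2 := by
    rw [Finset.sum_div, ← Finset.sum_add_distrib, ← Finset.sum_add_distrib, Finset.sum_div]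
    refine Finset.sum_congr rfl fun j _ => ?_
    simp; ring
  have h2 : ∑ i, φ i ((1 / 2 : ℝ) • (x + y)) ^ 2 + (∑ i, (φ i x - φ i y) ^ 2) / 4
      ≤ (∑ i, φ i x ^ 2 + ∑ i, φ i y ^ 2) / 2 := by
    rw [Finset.sum_div, ← Finset.sum_add_distrib, ← Finset.sum_add_distrib, Finset.sum_div]
    refine Finset.sum_le_sum fun i _ => ?_
    have := pow_le_pow_left₀ (apply_nonneg _ _) (seminorm_midpoint_le (φ i) x y) 2
    nlinarith
  have h3 := div_le_div_of_nonneg_right h2 (sq_nonneg K)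
  unfold chainEnergy
  have e1 : (∑ i, φ i ((1 / 2 : ℝ) • (x + y)) ^ 2 + (∑ i, (φ i x - φ i y) ^ 2) / 4) / K ^ 2
      = (∑ i, φ i ((1 / 2 : ℝ) • (x + y)) ^ 2) / K ^ 2
        + (∑ i, (φ i x - φ i y) ^ 2) / K ^ 2 / 4 := by ring
  have e2 : (∑ i, φ i x ^ 2 + ∑ i, φ i y ^ 2) / 2 / K ^ 2
      = ((∑ i, φ i x ^ 2) / K ^ 2 + (∑ i, φ i y ^ 2) / K ^ 2) / 2 := by ring
  rw [e1, e2] at h3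
  linarith

lemma sum_sq_sub_sq_le (x y : Fin n → ℝ) :
    ∑ i, (φ i x ^ 2 - φ i y ^ 2) ^ 2 ≤ chainDist φ x y ^ 2 := by
  rw [sq_chainDist]
  refine Finset.sum_le_sum fun i _ => ?_
  have h : |φ i x - φ i y| ≤ φ i (x - y) := abs_sub_map_le_sub (φ i) x y
  have h2 := pow_le_pow_left₀ (abs_nonneg _) h 2
  rw [sq_abs] at h2
  have : (φ i x ^ 2 - φ i y ^ 2) ^ 2 = (φ i x - φ i y) ^ 2 * (φ i x + φ i y) ^ 2 := by ring
  rw [this, mul_pow]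
  gcongr

lemma continuous_seminorm_of_sq_le (ψ : Seminorm ℝ (Fin n → ℝ)) {M : ℝ}
    (hψ : ∀ x, ψ x ^ 2 ≤ M ^ 2 * ∑ j, x j ^ 2) : Continuous ψ := by
  refine Seminorm.continuous_of_le (q := (‖M‖₊ * (n : NNReal)) • normSeminorm ℝ (Fin n → ℝ)) ?_ ?_
  · exact (continuous_const.mul continuous_norm)
  · intro x
    have h1 : ∑ j, x j ^ 2 ≤ (n * ‖x‖) ^ 2 := by
      calc ∑ j, x j ^ 2 ≤ ∑ _j : Fin n, ‖x‖ ^ 2 := by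
            refine Finset.sum_le_sum fun j _ => ?_
            rw [← sq_abs]
            exact pow_le_pow_left₀ (abs_nonneg _) (norm_le_pi_norm x j) 2
        _ = n * ‖x‖ ^ 2 := by simp
        _ ≤ (n * ‖x‖) ^ 2 := by
            rw [mul_pow]; gcongr
            have : n ≤ n ^ 2 := Nat.le_self_pow (by norm_num) n
            exact_mod_cast this
    have h2 : ψ x ^ 2 ≤ (|M| * (n * ‖x‖)) ^ 2 := by
      rw [mul_pow, sq_abs]; exact (hψ x).trans (by gcongr)
    have h3 := abs_le_of_sq_le_sq h2 (by positivity)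
    have : ((‖M‖₊ * (n : NNReal)) • normSeminorm ℝ (Fin n → ℝ)) x = |M| * (n * ‖x‖) := by
      simp [NNReal.smul_def, mul_assoc]
    rw [this]
    exact (le_abs_self _).trans h3

lemma exists_chain_minimizer (hφ : ∀ i, Continuous (φ i)) (K : ℝ) {t : ℝ} (ht : 0 ≤ t)
    (x : Fin n → ℝ) : ∃ y, ∀ z, chainEnergy φ K y + t * chainDist φ x y
      ≤ chainEnergy φ K z + t * chainDist φ x z := by
  refine Continuous.exists_forall_le (f := fun y => chainEnergy φ K y + t * chainDist φ x y) ?_ ?_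
  · unfold chainEnergy chainDist
    have hsub : ∀ i, Continuous fun a => φ i (x - a) := fun i =>
      (hφ i).comp (continuous_const.sub continuous_id)
    fun_prop
  · refine Filter.tendsto_atTop_mono (f := fun y => ‖y‖ ^ 2) (fun y => ?_) ?_
    · have h1 : ‖y‖ ^ 2 ≤ ∑ j, y j ^ 2 := by
        have h : ‖y‖ ≤ √(∑ j, y j ^ 2) := by
          refine (pi_norm_le_iff_of_nonneg (Real.sqrt_nonneg _)).2 fun j => ?_
          refine Real.le_sqrt_of_sq_le ?_
          rw [Real.norm_eq_abs, sq_abs]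
          exact Finset.single_le_sum (f := fun j => y j ^ 2) (fun j _ => sq_nonneg _)
            (Finset.mem_univ j)
        have := pow_le_pow_left₀ (norm_nonneg _) h 2
        rwa [Real.sq_sqrt (Finset.sum_nonneg fun j _ => sq_nonneg _)] at this
      have h2 := mul_nonneg ht (chainDist_nonneg φ x y)
      have h3 : 0 ≤ (∑ i, φ i y ^ 2) / K ^ 2 := by positivity
      simp only [chainEnergy]
      linarith
    · exact (Filter.tendsto_pow_atTop two_ne_zero).comp (tendsto_norm_cocompact_atTop)

end Geometry

section Labels

lemma exists_separated_net {α : Type*} [DecidableEq α] (q : α → α → ℝ)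
    (hq : ∀ x y, q x y = q y x) (hq0 : ∀ x, q x x = 0) {ε : ℝ} (hε : 0 ≤ ε) (A : Finset α) :
    ∃ P ⊆ A, (∀ x ∈ P, ∀ y ∈ P, x ≠ y → ε < q x y) ∧ ∀ x ∈ A, ∃ p ∈ P, q x p ≤ ε := by
  induction A using Finset.induction with
  | empty => exact ⟨∅, by simp⟩
  | insert a A _ ih =>
    obtain ⟨P, hPA, hsep, hnet⟩ := ih
    by_cases h : ∃ p ∈ P, q a p ≤ ε
    · refine ⟨P, hPA.trans (Finset.subset_insert _ _), hsep, fun x hx => ?_⟩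
      rcases Finset.mem_insert.1 hx with rfl | hx
      · exact h
      · exact hnet x hx
    · push Not at h
      refine ⟨insert a P, Finset.insert_subset_insert _ hPA, fun x hx y hy hxy => ?_,
        fun x hx => ?_⟩
      · rcases Finset.mem_insert.1 hx with rfl | hxP
        · rcases Finset.mem_insert.1 hy with rfl | hyP
          · exact absurd rfl hxy
          · exact h y hyP
        · rcases Finset.mem_insert.1 hy with rfl | hyP
          · rw [hq]; exact h x hxP
          · exact hsep x hxP y hyP hxy
      · rcases Finset.mem_insert.1 hx with rfl | hx
        · exact ⟨x, Finset.mem_insert_self _ _, by rw [hq0]; exact hε⟩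
        · obtain ⟨p, hp, hxp⟩ := hnet x hx
          exact ⟨p, Finset.mem_insert_of_mem hp, hxp⟩

lemma two_mul_pow_mul_exp_le {n k k₀ : ℕ} (hn : n ≤ 4 ^ k₀) :
    2 * ((1 / 2 : ℝ) ^ (k - k₀))⁻¹ ^ n * Real.exp ((2 ^ k) ^ 2 / 2) ≤ Real.exp (3 * 4 ^ k) := by
  have h1 : (2 : ℝ) ≤ Real.exp 1 := by have := Real.add_one_le_exp 1; linarith
  have hjn : (k - k₀) * n ≤ 4 ^ k := by
    rcases le_total k k₀ with h | h
    · simp [Nat.sub_eq_zero_of_le h]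
    · calc (k - k₀) * n ≤ 4 ^ (k - k₀) * 4 ^ k₀ :=
            Nat.mul_le_mul (Nat.lt_pow_self (by norm_num)).le hn
        _ = 4 ^ k := by rw [← pow_add, Nat.sub_add_cancel h]
  have h2 : ((1 / 2 : ℝ) ^ (k - k₀))⁻¹ ^ n ≤ Real.exp (4 ^ k) := by
    calc ((1 / 2 : ℝ) ^ (k - k₀))⁻¹ ^ n = 2 ^ ((k - k₀) * n) := by
          rw [pow_mul]; congr 1; rw [← inv_pow]; norm_num
      _ ≤ 2 ^ (4 ^ k) := pow_le_pow_right₀ (by norm_num) hjn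
      _ ≤ Real.exp 1 ^ (4 ^ k) := by gcongr
      _ = Real.exp (4 ^ k) := by rw [← Real.exp_nat_mul]; simp
  have h3 : ((2 : ℝ) ^ k) ^ 2 = 4 ^ k := by rw [← pow_mul, mul_comm, pow_mul]; norm_num
  have h4 : (1 : ℝ) ≤ 4 ^ k := one_le_pow₀ (by norm_num)
  calc 2 * ((1 / 2 : ℝ) ^ (k - k₀))⁻¹ ^ n * Real.exp ((2 ^ k) ^ 2 / 2)
      ≤ Real.exp 1 * Real.exp (4 ^ k) * Real.exp (4 ^ k / 2) := by rw [h3]; gcongr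
    _ = Real.exp (1 + 4 ^ k + 4 ^ k / 2) := by rw [Real.exp_add, Real.exp_add]
    _ ≤ Real.exp (3 * 4 ^ k) := Real.exp_le_exp.2 (by linarith)

lemma exists_label_of_gaussian_bound {n : ℕ} (Q : (Fin n → ℝ) → ℝ) (hQc : Continuous Q)
    (hQ0 : ∀ x, 0 ≤ Q x) (hQsub : ∀ x y, Q (x - y) ≤ 2 * Q x + 2 * Q y)
    (hQsmul : ∀ (c : ℝ) x, Q (c • x) = c ^ 2 * Q x)
    (hQint : MeasureTheory.Integrable fun x => Q x * gaussWeight x)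
    (hQle : ∫ x, Q x * gaussWeight x ≤ ∫ x : Fin n → ℝ, gaussWeight x) {k k₀ : ℕ}
    (hn : n ≤ 4 ^ k₀) {r : ℝ} (hr : 0 < r) (A : Finset (Fin n → ℝ)) (z : Fin n → ℝ)
    (hA : ∀ x ∈ A, ∑ j, (x - z) j ^ 2 ≤ r ^ 2) :
    ∃ g : (Fin n → ℝ) → (Fin n → ℝ), ((A.image g).card : ℝ) ≤ Real.exp (3 * 4 ^ k) ∧
      ∀ x ∈ A, ∀ y ∈ A, g x = g y →
        Q (x - y) ≤ 32 * ((1 / 2) ^ (k - k₀)) ^ 2 * r ^ 2 / 4 ^ k := by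
  set δ : ℝ := (1 / 2) ^ (k - k₀) with hδ
  have hδ0 : 0 < δ := by positivity
  have hδ1 : δ ≤ 1 := pow_le_one₀ (by norm_num) (by norm_num)
  have hQneg : ∀ x, Q (-x) = Q x := fun x => by
    have := hQsmul (-1) x; simpa using this
  have hQz : Q 0 = 0 := by have := hQsmul 0 0; simpa using this
  obtain ⟨P, hPA, hsep, hnet⟩ := exists_separated_net (fun x y => Q (x - y))
    (fun x y => by rw [← hQneg, neg_sub]) (fun x => by simp [hQz])
    (show (0 : ℝ) ≤ 8 * δ ^ 2 * r ^ 2 / 4 ^ k by positivity) A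
  choose! g hgP hg using hnet
  set c : ℝ := 2 ^ k / r with hc
  have hc0 : 0 < c := by positivity
  have h4 : ((2 : ℝ) ^ k) ^ 2 = 4 ^ k := by rw [← pow_mul, mul_comm, pow_mul]; norm_num
  have hc2 : c ^ 2 = 4 ^ k / r ^ 2 := by rw [hc, div_pow, h4]
  have hinj : Function.Injective fun x : Fin n → ℝ => c • (x - z) := fun x y h => by
    have := smul_right_injective _ hc0.ne' h
    exact sub_left_injective this
  have hcard := card_packing_le Q hQc hQ0 hQsub hQsmul hQint hQle hδ0 hδ1
    (R := 2 ^ k) (P.image fun x => c • (x - z)) (by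
      intro x hx
      obtain ⟨y, hy, rfl⟩ := Finset.mem_image.1 hx
      have h := hA y (hPA hy)
      calc ∑ i, (c • (y - z)) i ^ 2 = c ^ 2 * ∑ i, (y - z) i ^ 2 := by
            simp only [Pi.smul_apply, smul_eq_mul, mul_pow, Finset.mul_sum]
        _ ≤ c ^ 2 * r ^ 2 := by gcongr
        _ = (2 ^ k) ^ 2 := by rw [hc2, h4]; field_simp) (by
      intro x hx y hy hxy
      obtain ⟨x, hx', rfl⟩ := Finset.mem_image.1 hx
      obtain ⟨y, hy', rfl⟩ := Finset.mem_image.1 hy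
      have h := hsep x hx' y hy' (fun h => hxy (by rw [h]))
      have e : c • (x - z) - c • (y - z) = c • (x - y) := by rw [← smul_sub]; congr 1; abel
      rw [e, hQsmul, hc2]
      calc 8 * δ ^ 2 = 4 ^ k / r ^ 2 * (8 * δ ^ 2 * r ^ 2 / 4 ^ k) := by field_simp
        _ < _ := by gcongr)
  rw [Finset.card_image_of_injective _ hinj] at hcard
  refine ⟨g, ?_, fun x hx y hy hxy => ?_⟩
  · refine le_trans ?_ (hcard.trans (two_mul_pow_mul_exp_le hn))
    exact_mod_cast Finset.card_le_card (Finset.image_subset_iff.2 hgP)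
  · have h := hQsub (x - g x) (y - g x)
    rw [sub_sub_sub_cancel_right] at h
    have h1 := hg x hx
    have h2 := hg y hy
    rw [← hxy] at h2
    calc Q (x - y) ≤ 4 * (8 * δ ^ 2 * r ^ 2 / 4 ^ k) := by linarith
      _ = _ := by ring

end Labels

section Step

open MeasureTheory

/-- The standing assumptions of the chaining argument: `ψ` dominates every `φ i`, and the Gaussian
second moments of `φ i` and `ψ` are of order `M ^ 2 * b` and `M ^ 2 * a` respectively. -/
structure ChainBounds {n m : ℕ} (φ : Fin m → Seminorm ℝ (Fin n → ℝ))
    (ψ : Seminorm ℝ (Fin n → ℝ)) (K M a b : ℝ) : Prop where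
  K_pos : 0 < K
  M_pos : 0 < M
  a_ge : 1 / 2 ≤ a
  b_ge : 1 / 2 ≤ b
  le : ∀ i x, φ i x ≤ ψ x
  le_norm : ∀ x, ψ x ^ 2 ≤ M ^ 2 * ∑ j, x j ^ 2
  integrable_sq : ∀ i, Integrable fun x => φ i x ^ 2 * gaussWeight x
  integral_sq_le : ∀ i, ∫ x, φ i x ^ 2 * gaussWeight x
    ≤ 32 * M ^ 2 * b * ∫ x : Fin n → ℝ, gaussWeight x
  integrable_sq_max : Integrable fun x => ψ x ^ 2 * gaussWeight x
  integral_sq_max_le : ∫ x, ψ x ^ 2 * gaussWeight x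
    ≤ 32 * M ^ 2 * a * ∫ x : Fin n → ℝ, gaussWeight x

variable {n m : ℕ} {φ : Fin m → Seminorm ℝ (Fin n → ℝ)} {ψ : Seminorm ℝ (Fin n → ℝ)}
  {K M a b : ℝ}

lemma ChainBounds.continuous_max (H : ChainBounds φ ψ K M a b) : Continuous ψ :=
  continuous_seminorm_of_sq_le ψ H.le_norm

lemma ChainBounds.continuous (H : ChainBounds φ ψ K M a b) (i : Fin m) : Continuous (φ i) :=
  continuous_seminorm_of_sq_le (φ i) fun x =>
    (pow_le_pow_left₀ (apply_nonneg _ _) (H.le i x) 2).trans (H.le_norm x)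

lemma seminorm_sub_sq_le (p : Seminorm ℝ (Fin n → ℝ)) (x y : Fin n → ℝ) :
    p (x - y) ^ 2 ≤ 2 * p x ^ 2 + 2 * p y ^ 2 := by
  have h := pow_le_pow_left₀ (apply_nonneg _ _) (map_sub_le_add p x y) 2
  nlinarith [sq_nonneg (p x - p y)]

lemma seminorm_smul_sq (p : Seminorm ℝ (Fin n → ℝ)) (c : ℝ) (x : Fin n → ℝ) :
    p (c • x) ^ 2 = c ^ 2 * p x ^ 2 := by
  rw [map_smul_eq_mul, mul_pow, Real.norm_eq_abs, sq_abs]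

lemma ChainBounds.exists_label (H : ChainBounds φ ψ K M a b) {k k₀ : ℕ} (hn : n ≤ 4 ^ k₀)
    {r : ℝ} (hr : 0 < r) (A : Finset (Fin n → ℝ)) (z : Fin n → ℝ)
    (hz : ∑ i, φ i z ^ 2 ≤ 2 * K ^ 2) (hA : ∀ x ∈ A, ∑ j, (x - z) j ^ 2 ≤ r ^ 2) :
    ∃ g : (Fin n → ℝ) → (Fin n → ℝ), ((A.image g).card : ℝ) ≤ Real.exp (3 * 4 ^ k) ∧
      ∀ x ∈ A, ∀ y ∈ A, g x = g y →
        ∑ i, φ i z ^ 2 * φ i (x - y) ^ 2 ≤ 128 * K ^ 2 * M ^ 2 * b *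
          (32 * ((1 / 2) ^ (k - k₀)) ^ 2 * r ^ 2 / 4 ^ k) ∧
        ψ (x - y) ^ 2 ≤ 64 * M ^ 2 * a * (32 * ((1 / 2) ^ (k - k₀)) ^ 2 * r ^ 2 / 4 ^ k) := by
  have hK := H.K_pos
  have hM := H.M_pos
  have ha : 0 < a := by linarith [H.a_ge]
  have hb : 0 < b := by linarith [H.b_ge]
  have hφc := H.continuous
  have hψc := H.continuous_max
  set Q : (Fin n → ℝ) → ℝ := fun x => (∑ i, φ i z ^ 2 * φ i x ^ 2) / (128 * K ^ 2 * M ^ 2 * b)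
    + ψ x ^ 2 / (64 * M ^ 2 * a) with hQ
  set G := ∫ x : Fin n → ℝ, gaussWeight x with hG
  have hG0 : 0 < G := integral_gaussWeight_pos
  have hQw : ∀ x, Q x * gaussWeight x = (∑ i, φ i z ^ 2 * (φ i x ^ 2 * gaussWeight x))
      * (128 * K ^ 2 * M ^ 2 * b)⁻¹ + ψ x ^ 2 * gaussWeight x * (64 * M ^ 2 * a)⁻¹ := by
    intro x
    simp only [hQ, ← mul_assoc, ← Finset.sum_mul]
    ring
  have hint1 : Integrable fun x => (∑ i, φ i z ^ 2 * (φ i x ^ 2 * gaussWeight x))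
      * (128 * K ^ 2 * M ^ 2 * b)⁻¹ :=
    (integrable_finsetSum _ fun i _ => (H.integrable_sq i).const_mul _).mul_const _
  have hint2 : Integrable fun x => ψ x ^ 2 * gaussWeight x * (64 * M ^ 2 * a)⁻¹ :=
    H.integrable_sq_max.mul_const _
  obtain ⟨g, hg, hg'⟩ := exists_label_of_gaussian_bound Q (by simp only [hQ]; fun_prop)
    (fun x => by simp only [hQ]; positivity) (fun x y => by
      have h1 : ∑ i, φ i z ^ 2 * φ i (x - y) ^ 2
          ≤ 2 * ∑ i, φ i z ^ 2 * φ i x ^ 2 + 2 * ∑ i, φ i z ^ 2 * φ i y ^ 2 := by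
        rw [Finset.mul_sum, Finset.mul_sum, ← Finset.sum_add_distrib]
        refine Finset.sum_le_sum fun i _ => ?_
        have := mul_le_mul_of_nonneg_left (seminorm_sub_sq_le (φ i) x y) (sq_nonneg (φ i z))
        linarith
      have h1' := div_le_div_of_nonneg_right h1
        (show 0 ≤ 128 * K ^ 2 * M ^ 2 * b by positivity)
      have h2' := div_le_div_of_nonneg_right (seminorm_sub_sq_le ψ x y)
        (show 0 ≤ 64 * M ^ 2 * a by positivity)
      rw [add_div, mul_div_assoc, mul_div_assoc] at h1' h2'
      simp only [hQ]
      linarith) (fun c x => by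
      have : ∑ i, φ i z ^ 2 * φ i (c • x) ^ 2 = c ^ 2 * ∑ i, φ i z ^ 2 * φ i x ^ 2 := by
        rw [Finset.mul_sum]
        exact Finset.sum_congr rfl fun i _ => by rw [seminorm_smul_sq]; ring
      simp only [hQ]
      rw [this, seminorm_smul_sq]; ring) (by simp only [hQw]; exact hint1.add hint2) (by
      simp only [hQw]
      rw [integral_add hint1 hint2, integral_mul_const, integral_mul_const,
        integral_finsetSum _ fun i _ => (H.integrable_sq i).const_mul _]
      simp only [integral_const_mul]
      have h1 : ∑ i, φ i z ^ 2 * ∫ x, φ i x ^ 2 * gaussWeight x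
          ≤ 2 * K ^ 2 * (32 * M ^ 2 * b * G) := by
        calc _ ≤ ∑ i, φ i z ^ 2 * (32 * M ^ 2 * b * G) := by
              refine Finset.sum_le_sum fun i _ => ?_
              exact mul_le_mul_of_nonneg_left (H.integral_sq_le i) (sq_nonneg _)
          _ ≤ _ := by rw [← Finset.sum_mul]; gcongr
      calc _ ≤ 2 * K ^ 2 * (32 * M ^ 2 * b * G) * (128 * K ^ 2 * M ^ 2 * b)⁻¹
            + 32 * M ^ 2 * a * G * (64 * M ^ 2 * a)⁻¹ := by
            gcongr
            exact H.integral_sq_max_le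
        _ = G := by field_simp; norm_num)
      hn hr A z hA
  refine ⟨g, hg, fun x hx y hy hxy => ?_⟩
  have h := hg' x hx y hy hxy
  simp only [hQ] at h
  constructor
  · refine (div_le_iff₀' (by positivity)).1 (le_trans ?_ h)
    exact le_add_of_nonneg_right (by positivity)
  · refine (div_le_iff₀' (by positivity)).1 (le_trans ?_ h)
    exact le_add_of_nonneg_left (by positivity)

lemma chainDist_sq_le_of_near (H : ChainBounds φ ψ K M a b) {r : ℝ} (x y z : Fin n → ℝ)
    (hx : ∑ i, (φ i x - φ i z) ^ 2 ≤ r ^ 2 * K ^ 2)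
    (hy : ∑ i, (φ i y - φ i z) ^ 2 ≤ r ^ 2 * K ^ 2) :
    chainDist φ x y ^ 2 ≤ 12 * ∑ i, φ i z ^ 2 * φ i (x - y) ^ 2
      + 6 * ψ (x - y) ^ 2 * (r ^ 2 * K ^ 2) := by
  rw [sq_chainDist]
  calc ∑ i, (φ i (x - y) * (φ i x + φ i y)) ^ 2
      ≤ ∑ i, (12 * (φ i z ^ 2 * φ i (x - y) ^ 2) + 3 * ψ (x - y) ^ 2 * (φ i x - φ i z) ^ 2
          + 3 * ψ (x - y) ^ 2 * (φ i y - φ i z) ^ 2) := by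
        refine Finset.sum_le_sum fun i _ => ?_
        have h1 : (φ i x + φ i y) ^ 2
            ≤ 12 * φ i z ^ 2 + 3 * (φ i x - φ i z) ^ 2 + 3 * (φ i y - φ i z) ^ 2 := by
          nlinarith [sq_nonneg (φ i x - φ i y), sq_nonneg (φ i x - φ i z - 2 * φ i z),
            sq_nonneg (φ i y - φ i z - 2 * φ i z)]
        have h2 := pow_le_pow_left₀ (apply_nonneg _ _) (H.le i (x - y)) 2
        calc _ = φ i (x - y) ^ 2 * (φ i x + φ i y) ^ 2 := by ring
          _ ≤ φ i (x - y) ^ 2 *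
            (12 * φ i z ^ 2 + 3 * (φ i x - φ i z) ^ 2 + 3 * (φ i y - φ i z) ^ 2) := by gcongr
          _ = 12 * (φ i z ^ 2 * φ i (x - y) ^ 2)
            + φ i (x - y) ^ 2 * (3 * (φ i x - φ i z) ^ 2 + 3 * (φ i y - φ i z) ^ 2) := by ring
          _ ≤ 12 * (φ i z ^ 2 * φ i (x - y) ^ 2)
            + ψ (x - y) ^ 2 * (3 * (φ i x - φ i z) ^ 2 + 3 * (φ i y - φ i z) ^ 2) := by gcongr
          _ = _ := by ring
    _ = 12 * ∑ i, φ i z ^ 2 * φ i (x - y) ^ 2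
        + 3 * ψ (x - y) ^ 2 * ∑ i, (φ i x - φ i z) ^ 2
        + 3 * ψ (x - y) ^ 2 * ∑ i, (φ i y - φ i z) ^ 2 := by
        rw [Finset.sum_add_distrib, Finset.sum_add_distrib, Finset.mul_sum, Finset.mul_sum,
          Finset.mul_sum]
    _ ≤ 12 * ∑ i, φ i z ^ 2 * φ i (x - y) ^ 2 + 3 * ψ (x - y) ^ 2 * (r ^ 2 * K ^ 2)
        + 3 * ψ (x - y) ^ 2 * (r ^ 2 * K ^ 2) := by gcongr
    _ = _ := by ring

/-- Minimizers of the penalized energy attached to two nearby points are close to each other. -/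
lemma minimizers_close {φ : Fin m → Seminorm ℝ (Fin n → ℝ)} (hK : 0 < K) {t σ Δ : ℝ} (ht : 0 ≤ t)
    {x₁ x₂ y₁ y₂ : Fin n → ℝ}
    (h₁ : ∀ z, chainEnergy φ K y₁ + t * chainDist φ x₁ y₁
      ≤ chainEnergy φ K z + t * chainDist φ x₁ z)
    (h₂ : ∀ z, chainEnergy φ K y₂ + t * chainDist φ x₂ y₂
      ≤ chainEnergy φ K z + t * chainDist φ x₂ z)
    (hσ₁ : chainDist φ x₁ y₁ ≤ σ) (hσ₂ : chainDist φ x₂ y₂ ≤ σ) (hΔ : chainDist φ x₁ x₂ ≤ Δ) :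
    ∑ j, (y₁ - y₂) j ^ 2 ≤ 336 * (t * (Δ + σ)) ∧
      ∑ i, (φ i y₁ - φ i y₂) ^ 2 ≤ 336 * (t * (Δ + σ)) * K ^ 2 := by
  have hΔ0 := (chainDist_nonneg φ x₁ x₂).trans hΔ
  have d12 : chainDist φ y₁ y₂ ≤ 16 * Δ + 20 * σ := by
    have h1 := chainDist_triangle φ y₁ x₁ y₂
    have h2 := chainDist_triangle φ x₁ x₂ y₂
    rw [chainDist_comm φ y₁ x₁] at h1
    linarith
  set z := (1 / 2 : ℝ) • (y₁ + y₂) with hz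
  have dz1 : chainDist φ x₁ z ≤ 84 * (Δ + σ) := by
    have h1 := chainDist_triangle φ x₁ y₁ z
    have h2 := chainDist_midpoint_le φ y₁ y₂
    linarith
  have dz2 : chainDist φ x₂ z ≤ 84 * (Δ + σ) := by
    have h1 := chainDist_triangle φ x₂ y₂ z
    have h2 := chainDist_midpoint_le φ y₂ y₁
    rw [add_comm, chainDist_comm φ y₂ y₁] at h2
    linarith
  have e1 := h₁ z
  have e2 := h₂ z
  have n1 := mul_nonneg ht (chainDist_nonneg φ x₁ y₁)
  have n2 := mul_nonneg ht (chainDist_nonneg φ x₂ y₂)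
  have m1 := mul_le_mul_of_nonneg_left dz1 ht
  have m2 := mul_le_mul_of_nonneg_left dz2 ht
  have hmid := chainEnergy_midpoint_le φ K y₁ y₂
  rw [← hz] at hmid
  have p1 : 0 ≤ ∑ j, (y₁ - y₂) j ^ 2 := Finset.sum_nonneg fun _ _ => sq_nonneg _
  have p2 : 0 ≤ (∑ i, (φ i y₁ - φ i y₂) ^ 2) / K ^ 2 := by positivity
  refine ⟨by nlinarith, (div_le_iff₀ (by positivity)).1 (by nlinarith)⟩

end Step

section Refine

variable {n m : ℕ} {φ : Fin m → Seminorm ℝ (Fin n → ℝ)} {ψ : Seminorm ℝ (Fin n → ℝ)}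
  {K M a b : ℝ}

lemma chainDist_self (x : Fin n → ℝ) : chainDist φ x x = 0 := by simp [chainDist]

lemma refine_arith {L K M a b B δ p q : ℝ} (k : ℕ) (hL : 0 < L)
    (hLsq : L ^ 2 = M ^ 2 * K ^ 2 * (a * b)) (ha : 1 / 2 ≤ a) (hb : 1 / 2 ≤ b) (hB : 0 ≤ B)
    (hδ0 : 0 ≤ δ) (hδ1 : δ ≤ 1) {R : ℝ} (hR : R = 336 * (2 ^ k / (1056964608 * L) * B))
    (hp : p ≤ 128 * K ^ 2 * M ^ 2 * b * (32 * δ ^ 2 * R / 4 ^ k))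
    (hq : q ≤ 64 * M ^ 2 * a * (32 * δ ^ 2 * R / 4 ^ k)) :
    12 * p + 6 * q * (R * K ^ 2) ≤ (B / 64 + L * δ ^ 2 / (a * 2 ^ k)) ^ 2 := by
  have ha0 : 0 < a := by linarith
  have hb0 : 0 < b := by linarith
  have h2 : (0 : ℝ) < 2 ^ k := by positivity
  have h4 : (4 : ℝ) ^ k = 2 ^ k * 2 ^ k := by rw [← mul_pow]; norm_num
  have hR0 : 0 ≤ R := by rw [hR]; positivity
  set Y := L * δ ^ 2 / (a * 2 ^ k) with hY
  have hY0 : 0 ≤ Y := by positivity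
  have e1 : 12 * (128 * K ^ 2 * M ^ 2 * b * (32 * δ ^ 2 * R / 4 ^ k)) = B / 64 * Y := by
    have : 12 * (128 * K ^ 2 * M ^ 2 * b * (32 * δ ^ 2 * R / 4 ^ k))
        = 49152 * (M ^ 2 * K ^ 2 * (a * b)) * (δ ^ 2 * R / (a * 4 ^ k)) := by
      field_simp; ring
    rw [this, ← hLsq, hY, h4, hR]
    field_simp; ring
  have e2 : 6 * (64 * M ^ 2 * a * (32 * δ ^ 2 * R / 4 ^ k)) * (R * K ^ 2)
      ≤ (B / 64) ^ 2 := by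
    have : 6 * (64 * M ^ 2 * a * (32 * δ ^ 2 * R / 4 ^ k)) * (R * K ^ 2)
        = 12288 * (M ^ 2 * K ^ 2 * (a * b)) * (δ ^ 2 * R ^ 2 / (b * 4 ^ k)) := by
      field_simp; ring
    rw [this, ← hLsq, h4, hR]
    have : 12288 * L ^ 2 * (δ ^ 2 * (336 * (2 ^ k / (1056964608 * L) * B)) ^ 2
        / (b * (2 ^ k * 2 ^ k))) = 12288 * 336 ^ 2 / 1056964608 ^ 2 * (B ^ 2 * (δ ^ 2 / b)) := by
      field_simp
    rw [this]
    have h5 : δ ^ 2 / b ≤ 2 := by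
      rw [div_le_iff₀ hb0]; nlinarith
    have h6 := mul_le_mul_of_nonneg_left h5 (sq_nonneg B)
    nlinarith [sq_nonneg B]
  have f1 : 12 * p ≤ B / 64 * Y := by rw [← e1]; gcongr
  have f2 : 6 * q * (R * K ^ 2) ≤ (B / 64) ^ 2 := by
    refine le_trans ?_ e2; gcongr
  nlinarith [mul_nonneg hB hY0, sq_nonneg Y]

/-- One step of the chaining: a cell of `chainDist`-diameter `Δ` on which all penalized minimizers
are within `σ` splits into few cells of much smaller diameter. -/
lemma exists_refining_label (H : ChainBounds φ ψ K M a b) {k k₀ : ℕ} (hn : n ≤ 4 ^ k₀)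
    {L : ℝ} (hL : 0 < L) (hLsq : L ^ 2 = M ^ 2 * K ^ 2 * (a * b))
    (π : (Fin n → ℝ) → Fin n → ℝ)
    (hπ : ∀ x z, chainEnergy φ K (π x) + 2 ^ k / (1056964608 * L) * chainDist φ x (π x)
      ≤ chainEnergy φ K z + 2 ^ k / (1056964608 * L) * chainDist φ x z)
    {σ Δ : ℝ} (hσ0 : 0 ≤ σ) (hΔ0 : 0 < Δ) (A : Finset (Fin n → ℝ))
    (hσ : ∀ x ∈ A, chainDist φ x (π x) ≤ σ)
    (hΔ : ∀ x ∈ A, ∀ y ∈ A, chainDist φ x y ≤ Δ) (hA : ∀ x ∈ A, chainEnergy φ K x ≤ 2) :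
    ∃ g : (Fin n → ℝ) → (Fin n → ℝ), ((A.image g).card : ℝ) ≤ Real.exp (3 * 4 ^ k) ∧
      ∀ x ∈ A, ∀ y ∈ A, g x = g y → chainDist φ x y ≤
        Δ / 4 + 21 * σ + 16 * (L * ((1 / 2) ^ (k - k₀)) ^ 2 / (a * 2 ^ k)) := by
  rcases A.eq_empty_or_nonempty with rfl | ⟨x₀, hx₀⟩
  · exact ⟨id, by simp; positivity, by simp⟩
  have hK := H.K_pos
  set t : ℝ := 2 ^ k / (1056964608 * L) with ht
  have ht0 : 0 < t := by positivity
  set R := 336 * (t * (Δ + σ)) with hR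
  have hR0 : 0 < R := by positivity
  have hRsq : √R ^ 2 = R := Real.sq_sqrt hR0.le
  have hclose : ∀ x ∈ A, ∀ y ∈ A, ∑ j, (π x - π y) j ^ 2 ≤ R ∧
      ∑ i, (φ i (π x) - φ i (π y)) ^ 2 ≤ R * K ^ 2 := fun x hx y hy =>
    minimizers_close hK ht0.le (hπ x) (hπ y) (hσ x hx) (hσ y hy) (hΔ x hx y hy)
  have hz : ∑ i, φ i (π x₀) ^ 2 ≤ 2 * K ^ 2 := by
    have h := hπ x₀ x₀
    rw [chainDist_self, mul_zero, add_zero] at h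
    have h1 := mul_nonneg ht0.le (chainDist_nonneg φ x₀ (π x₀))
    have h2 := hA x₀ hx₀
    refine (div_le_iff₀ (by positivity)).1 ?_
    have h3 : 0 ≤ ∑ j, π x₀ j ^ 2 := Finset.sum_nonneg fun _ _ => sq_nonneg _
    simp only [chainEnergy] at h h2 ⊢
    linarith
  obtain ⟨g, hg, hg'⟩ := H.exists_label (k := k) hn (Real.sqrt_pos.2 hR0) (A.image π) (π x₀) hz (by
    intro y hy
    obtain ⟨x, hx, rfl⟩ := Finset.mem_image.1 hy
    rw [hRsq]
    exact (hclose x hx x₀ hx₀).1)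
  rw [hRsq] at hg'
  refine ⟨g ∘ π, by rwa [← Finset.image_image], fun x hx y hy hxy => ?_⟩
  obtain ⟨hp, hq⟩ := hg' _ (Finset.mem_image_of_mem π hx) _ (Finset.mem_image_of_mem π hy) hxy
  have hnear := chainDist_sq_le_of_near H (r := √R) (π x) (π y) (π x₀)
    (by rw [hRsq]; exact (hclose x hx x₀ hx₀).2) (by rw [hRsq]; exact (hclose y hy x₀ hx₀).2)
  rw [hRsq] at hnear
  have hδ0 : (0 : ℝ) ≤ (1 / 2) ^ (k - k₀) := by positivity
  have ha : 0 < a := by linarith [H.a_ge]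
  have harith := refine_arith k hL hLsq H.a_ge H.b_ge (by positivity : 0 ≤ Δ + σ) hδ0
    (pow_le_one₀ (by norm_num) (by norm_num)) hR hp hq
  have hd := abs_le_of_sq_le_sq (hnear.trans harith) (by positivity)
  replace hd := (le_abs_self _).trans hd
  have t1 := chainDist_triangle φ x (π x) y
  have t2 := chainDist_triangle φ (π x) (π y) y
  rw [chainDist_comm φ (π y) y] at t2
  have s1 := hσ x hx
  have s2 := hσ y hy
  linarith

end Refine

section Recursion

/-- The diameters produced by iterating the refinement step. -/
noncomputable def cellDiam {V : Type*} (σ : ℕ → V → ℝ) (e : ℕ → ℝ) (Δ₀ : ℝ) : ℕ → V → ℝ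
  | 0, _ => Δ₀
  | k + 1, x => cellDiam σ e Δ₀ k x / 4 + 21 * σ k x + e k

lemma cellDiam_pos {V : Type*} {σ : ℕ → V → ℝ} {e : ℕ → ℝ} {Δ₀ : ℝ} (hσ : ∀ k x, 0 ≤ σ k x)
    (he : ∀ k, 0 ≤ e k) (hΔ₀ : 0 < Δ₀) (k : ℕ) (x : V) : 0 < cellDiam σ e Δ₀ k x := by
  induction k with
  | zero => exact hΔ₀
  | succ k ih =>
    have := hσ k x
    have := he k
    simp only [cellDiam]
    linarith

lemma sum_cellDiam_le {V : Type*} {σ : ℕ → V → ℝ} {e : ℕ → ℝ} {Δ₀ : ℝ} (hσ : ∀ k x, 0 ≤ σ k x)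
    (he : ∀ k, 0 ≤ e k) (hΔ₀ : 0 < Δ₀) (x : V) (N : ℕ) :
    ∑ k ∈ Finset.range N, 2 ^ k * cellDiam σ e Δ₀ k x
      ≤ 2 * Δ₀ + 4 * (21 * ∑ k ∈ Finset.range N, 2 ^ k * σ k x
        + ∑ k ∈ Finset.range N, 2 ^ k * e k) := by
  have h : ∑ k ∈ Finset.range N, 2 ^ k * cellDiam σ e Δ₀ k x + 2 * (2 ^ N * cellDiam σ e Δ₀ N x)
      = 2 * Δ₀ + 4 * (21 * ∑ k ∈ Finset.range N, 2 ^ k * σ k x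
        + ∑ k ∈ Finset.range N, 2 ^ k * e k) := by
    induction N with
    | zero => simp [cellDiam]
    | succ N ih =>
      rw [Finset.sum_range_succ, Finset.sum_range_succ, Finset.sum_range_succ]
      simp only [cellDiam]
      rw [pow_succ]
      linarith
  have := mul_pos (pow_pos (zero_lt_two' ℝ) N) (cellDiam_pos hσ he hΔ₀ N x)
  linarith

/-- Nested labels obtained by iterating the refinement `g`. -/
noncomputable def chainLabel {V : Type*} [DecidableEq V] (T : Finset V) (σ : ℕ → V → ℝ)
    (Δ : ℕ → V → ℝ) (g : ℕ → Finset V → ℝ → ℝ → V → V) : ℕ → V → List (ℝ × V)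
  | 0, _ => []
  | k + 1, x =>
    (σ k x, g k (T.filter fun y => chainLabel T σ Δ g k y = chainLabel T σ Δ g k x ∧ σ k y = σ k x)
      (σ k x) (Δ k x) x) :: chainLabel T σ Δ g k x

variable {V : Type*} [DecidableEq V] {T : Finset V} {σ : ℕ → V → ℝ} {e : ℕ → ℝ} {Δ₀ : ℝ}
  {g : ℕ → Finset V → ℝ → ℝ → V → V}

lemma chainLabel_succ_eq {Δ : ℕ → V → ℝ} {k : ℕ} {x y : V}
    (h : chainLabel T σ Δ g (k + 1) x = chainLabel T σ Δ g (k + 1) y) :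
    chainLabel T σ Δ g k x = chainLabel T σ Δ g k y ∧ σ k x = σ k y := by
  simp only [chainLabel, List.cons.injEq, Prod.mk.injEq] at h
  exact ⟨h.2, h.1.1⟩

lemma cellDiam_eq_of_chainLabel_eq {k : ℕ} {x y : V}
    (h : chainLabel T σ (cellDiam σ e Δ₀) g k x = chainLabel T σ (cellDiam σ e Δ₀) g k y) :
    cellDiam σ e Δ₀ k x = cellDiam σ e Δ₀ k y := by
  induction k with
  | zero => rfl
  | succ k ih =>
    obtain ⟨h1, h2⟩ := chainLabel_succ_eq h
    simp only [cellDiam]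
    rw [ih h1, h2]

lemma exists_nested_labels {V : Type*} [DecidableEq V] (T : Finset V) (d : V → V → ℝ)
    (σ : ℕ → V → ℝ) (e : ℕ → ℝ) {Δ₀ c : ℝ} (hc : 0 ≤ c) (hσ : ∀ k x, 0 ≤ σ k x)
    (he : ∀ k, 0 ≤ e k) (hΔ₀ : 0 < Δ₀) (hd : ∀ x ∈ T, ∀ y ∈ T, d x y ≤ Δ₀)
    (hσcard : ∀ k, ((T.image (σ k)).card : ℝ) ≤ Real.exp (c * 4 ^ k))
    (hstep : ∀ k, ∀ A ⊆ T, ∀ τ Δ : ℝ, 0 ≤ τ → 0 < Δ → (∀ x ∈ A, σ k x = τ) →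
      (∀ x ∈ A, ∀ y ∈ A, d x y ≤ Δ) → ∃ g : V → V,
        ((A.image g).card : ℝ) ≤ Real.exp (3 * 4 ^ k) ∧
        ∀ x ∈ A, ∀ y ∈ A, g x = g y → d x y ≤ Δ / 4 + 21 * τ + e k) :
    ∃ ℓ : ℕ → V → List (ℝ × V),
      (∀ x ∈ T, ∀ y ∈ T, ℓ 0 x = ℓ 0 y) ∧
      (∀ k, ∀ x ∈ T, ∀ y ∈ T, ℓ (k + 1) x = ℓ (k + 1) y → ℓ k x = ℓ k y) ∧
      (∀ k, ((T.image (ℓ k)).card : ℝ) ≤ Real.exp ((c + 3) * 4 ^ k)) ∧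
      (∀ k, ∀ x ∈ T, ∀ y ∈ T, ℓ k x = ℓ k y → cellDiam σ e Δ₀ k x = cellDiam σ e Δ₀ k y) ∧
      (∀ k, ∀ x ∈ T, ∀ y ∈ T, ℓ k x = ℓ k y → d x y ≤ cellDiam σ e Δ₀ k x) := by
  have : Nonempty (V → V) := ⟨id⟩
  choose! g hgcard hg using hstep
  set ℓ := chainLabel T σ (cellDiam σ e Δ₀) g with hℓ
  have hcell : ∀ k, ∀ x ∈ T, ∀ y ∈ T, ℓ k x = ℓ k y → d x y ≤ cellDiam σ e Δ₀ k x := by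
    intro k
    induction k with
    | zero => intro x hx y hy _; exact hd x hx y hy
    | succ k ih =>
      intro x hx y hy hxy
      obtain ⟨h1, h2⟩ := chainLabel_succ_eq hxy
      have h3 := cellDiam_eq_of_chainLabel_eq h1
      have h4 := hxy
      simp only [hℓ, chainLabel, List.cons.injEq, Prod.mk.injEq] at h4
      replace h4 := h4.1.2
      rw [← h1, ← h2, ← h3] at h4
      refine hg k _ (Finset.filter_subset _ _) (σ k x) (cellDiam σ e Δ₀ k x) (hσ k x)
        (cellDiam_pos hσ he hΔ₀ k x) (fun u hu => (Finset.mem_filter.1 hu).2.2)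
        (fun u hu v hv => ?_) x (by simp [hx]) y (by simp [hy, ← h1, ← h2]) h4
      obtain ⟨hu, hux, -⟩ := Finset.mem_filter.1 hu
      obtain ⟨hv, hvx, -⟩ := Finset.mem_filter.1 hv
      rw [← cellDiam_eq_of_chainLabel_eq hux]
      exact ih u hu v hv (hux.trans hvx.symm)
  refine ⟨ℓ, fun _ _ _ _ => rfl, fun k x _ y _ h => (chainLabel_succ_eq h).1, fun k => ?_,
    fun k x _ y _ h => cellDiam_eq_of_chainLabel_eq h, hcell⟩
  induction k with
  | zero =>
    have h1 : (T.image (ℓ 0)).card ≤ 1 :=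
      Finset.card_le_one.2 fun u hu v hv => by
        obtain ⟨x, -, rfl⟩ := Finset.mem_image.1 hu
        obtain ⟨y, -, rfl⟩ := Finset.mem_image.1 hv
        rfl
    calc ((T.image (ℓ 0)).card : ℝ) ≤ 1 := by exact_mod_cast h1
      _ ≤ _ := Real.one_le_exp (by positivity)
  | succ k ih =>
    set cell : List (ℝ × V) × ℝ → Finset V := fun p => T.filter fun y => ℓ k y = p.1 ∧ σ k y = p.2
      with hcellset
    have hcov : T.image (ℓ (k + 1)) ⊆ ((T.image (ℓ k)) ×ˢ (T.image (σ k))).biUnion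
        fun p => (cell p).image (ℓ (k + 1)) := by
      intro u hu
      obtain ⟨x, hx, rfl⟩ := Finset.mem_image.1 hu
      refine Finset.mem_biUnion.2 ⟨(ℓ k x, σ k x), ?_, ?_⟩
      · exact Finset.mem_product.2 ⟨Finset.mem_image_of_mem _ hx, Finset.mem_image_of_mem _ hx⟩
      · exact Finset.mem_image_of_mem _ (by simp [cell, hx])
    have hone : ∀ p, (((cell p).image (ℓ (k + 1))).card : ℝ) ≤ Real.exp (3 * 4 ^ k) := by
      intro p
      rcases (cell p).eq_empty_or_nonempty with h | ⟨x, hx⟩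
      · rw [h]; simp; positivity
      obtain ⟨hxT, hx1, hx2⟩ := Finset.mem_filter.1 hx
      have hsub : (cell p).image (ℓ (k + 1)) ⊆
          ((cell p).image (g k (cell p) p.2 (cellDiam σ e Δ₀ k x))).image
            fun v => (p.2, v) :: p.1 := by
        intro u hu
        obtain ⟨y, hy, rfl⟩ := Finset.mem_image.1 hu
        obtain ⟨hyT, hy1, hy2⟩ := Finset.mem_filter.1 hy
        rw [Finset.image_image]
        refine Finset.mem_image.2 ⟨y, hy, ?_⟩
        have h3 : cellDiam σ e Δ₀ k y = cellDiam σ e Δ₀ k x :=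
          cellDiam_eq_of_chainLabel_eq (hy1.trans hx1.symm)
        have h4 : ℓ (k + 1) y = (σ k y, g k (T.filter fun z => ℓ k z = ℓ k y ∧ σ k z = σ k y)
          (σ k y) (cellDiam σ e Δ₀ k y) y) :: ℓ k y := rfl
        rw [h4, hy1, hy2, h3]
        rfl
      refine le_trans ?_ (hgcard k (cell p) (Finset.filter_subset _ _) p.2
        (cellDiam σ e Δ₀ k x) (hx2 ▸ hσ k x) (cellDiam_pos hσ he hΔ₀ k x)
        (fun u hu => (Finset.mem_filter.1 hu).2.2) fun u hu v hv => ?_)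
      · exact_mod_cast (Finset.card_le_card hsub).trans Finset.card_image_le
      · obtain ⟨hu, hux, -⟩ := Finset.mem_filter.1 hu
        obtain ⟨hv, hvx, -⟩ := Finset.mem_filter.1 hv
        rw [← cellDiam_eq_of_chainLabel_eq (hux.trans hx1.symm)]
        exact hcell k u hu v hv (hux.trans hvx.symm)
    have h4k : (0 : ℝ) < 4 ^ k := by positivity
    calc ((T.image (ℓ (k + 1))).card : ℝ)
        ≤ ∑ p ∈ (T.image (ℓ k)) ×ˢ (T.image (σ k)), (((cell p).image (ℓ (k + 1))).card : ℝ) := by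
          exact_mod_cast (Finset.card_le_card hcov).trans Finset.card_biUnion_le
      _ ≤ ∑ p ∈ (T.image (ℓ k)) ×ˢ (T.image (σ k)), Real.exp (3 * 4 ^ k) :=
          Finset.sum_le_sum fun p _ => hone p
      _ = (T.image (ℓ k)).card * (T.image (σ k)).card * Real.exp (3 * 4 ^ k) := by
          rw [Finset.sum_const, Finset.card_product, nsmul_eq_mul]; push_cast; rfl
      _ ≤ Real.exp ((c + 3) * 4 ^ k) * Real.exp (c * 4 ^ k) * Real.exp (3 * 4 ^ k) := by
          gcongr
          exact hσcard k
      _ = Real.exp ((c + 3) * 4 ^ k + c * 4 ^ k + 3 * 4 ^ k) := by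
          rw [Real.exp_add, Real.exp_add]
      _ ≤ Real.exp ((c + 3) * 4 ^ (k + 1)) := by
          refine Real.exp_le_exp.2 ?_
          rw [pow_succ]
          nlinarith [mul_nonneg hc h4k.le]

end Recursion

section Chaining

variable {n m : ℕ} {φ : Fin m → Seminorm ℝ (Fin n → ℝ)} {ψ : Seminorm ℝ (Fin n → ℝ)}
  {K M a b : ℝ}

lemma sum_pow_tsub_le (k₀ N : ℕ) :
    ∑ k ∈ Finset.range N, (((1 / 2 : ℝ)) ^ (k - k₀)) ^ 2 ≤ k₀ + 2 := by
  have h : ∀ j : ℕ, ∑ k ∈ Finset.range (k₀ + j), (((1 / 2 : ℝ)) ^ (k - k₀)) ^ 2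
      ≤ k₀ + 2 - 2 * (1 / 2) ^ j := by
    intro j
    induction j with
    | zero =>
      calc _ ≤ ∑ k ∈ Finset.range k₀, (1 : ℝ) := Finset.sum_le_sum fun k _ =>
            pow_le_one₀ (by positivity) (pow_le_one₀ (by norm_num) (by norm_num))
        _ ≤ _ := by simp
    | succ j ih =>
      rw [← add_assoc, Finset.sum_range_succ, Nat.add_sub_cancel_left]
      have h0 : (0 : ℝ) < (1 / 2) ^ j := by positivity
      have h1 : ((1 / 2 : ℝ)) ^ j ≤ 1 := pow_le_one₀ (by norm_num) (by norm_num)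
      rw [pow_succ (1 / 2 : ℝ) j]
      nlinarith
  refine (Finset.sum_le_sum_of_subset_of_nonneg (Finset.range_mono (Nat.le_add_left N k₀))
    fun _ _ _ => by positivity).trans ((h N).trans ?_)
  have : (0 : ℝ) < (1 / 2) ^ N := by positivity
  linarith

/-- Along a geometric sequence of penalties, the distances to the penalized minimizers are
summable. -/
lemma sum_penalty_mul_dist_le {φ : Fin m → Seminorm ℝ (Fin n → ℝ)} {t : ℝ} (ht : 0 ≤ t)
    {x : Fin n → ℝ} {y : ℕ → Fin n → ℝ}
    (hy : ∀ k z, chainEnergy φ K (y k) + 2 ^ k * t * chainDist φ x (y k)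
      ≤ chainEnergy φ K z + 2 ^ k * t * chainDist φ x z) (N : ℕ) :
    ∑ k ∈ Finset.range N, 2 ^ k * (t * chainDist φ x (y k)) ≤ 2 * chainEnergy φ K x := by
  have h : ∀ N : ℕ, ∑ k ∈ Finset.range (N + 1), 2 ^ k * (t * chainDist φ x (y k))
      ≤ 2 * (chainEnergy φ K (y N) + 2 ^ N * t * chainDist φ x (y N)) := by
    intro N
    induction N with
    | zero =>
      have h1 := chainEnergy_nonneg φ K (y 0)
      have h2 := mul_nonneg ht (chainDist_nonneg φ x (y 0))
      simp
      linarith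
    | succ N ih =>
      rw [Finset.sum_range_succ]
      have h1 := hy N (y (N + 1))
      rw [pow_succ]
      linarith
  refine (Finset.sum_le_sum_of_subset_of_nonneg (Finset.range_mono (Nat.le_succ N))
    fun k _ _ => ?_).trans ((h N).trans ?_)
  · have := chainDist_nonneg φ x (y k)
    positivity
  · have h1 := hy N x
    rw [chainDist_self, mul_zero, add_zero] at h1
    linarith

lemma ChainBounds.chainDist_le (H : ChainBounds φ ψ K M a b) {x y : Fin n → ℝ}
    (hx : ∑ j, x j ^ 2 ≤ 1) (hy : ∑ j, y j ^ 2 ≤ 1) (hxK : ∑ i, φ i x ^ 2 ≤ K ^ 2)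
    (hyK : ∑ i, φ i y ^ 2 ≤ K ^ 2) : chainDist φ x y ≤ 4 * (M * K) := by
  have hK := H.K_pos
  have hM := H.M_pos
  refine Real.sqrt_le_iff.2 ⟨by positivity, ?_⟩
  have hψ : ψ (x - y) ^ 2 ≤ 4 * M ^ 2 := by
    have h1 := seminorm_sub_sq_le ψ x y
    have h2 := (H.le_norm x).trans (mul_le_mul_of_nonneg_left hx (sq_nonneg M))
    have h3 := (H.le_norm y).trans (mul_le_mul_of_nonneg_left hy (sq_nonneg M))
    linarith
  calc ∑ i, (φ i (x - y) * (φ i x + φ i y)) ^ 2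
      ≤ ∑ i, 4 * M ^ 2 * (2 * φ i x ^ 2 + 2 * φ i y ^ 2) := by
        refine Finset.sum_le_sum fun i _ => ?_
        have h1 := (pow_le_pow_left₀ (apply_nonneg _ _) (H.le i (x - y)) 2).trans hψ
        rw [mul_pow]
        gcongr
        nlinarith [sq_nonneg (φ i x - φ i y)]
    _ = 4 * M ^ 2 * (2 * ∑ i, φ i x ^ 2 + 2 * ∑ i, φ i y ^ 2) := by
        rw [← Finset.mul_sum, Finset.sum_add_distrib, ← Finset.mul_sum, ← Finset.mul_sum]
    _ ≤ 4 * M ^ 2 * (2 * K ^ 2 + 2 * K ^ 2) := by gcongr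
    _ = (4 * (M * K)) ^ 2 := by ring

lemma card_image_ceil_le {V : Type*} (T : Finset V) (s : V → ℝ) {L : ℝ} (hL : 0 < L) (k : ℕ)
    (hs : ∀ x ∈ T, s x ≤ 2113929216 * L / 2 ^ k) :
    ((T.image fun x => (⌈s x * 4 ^ k / L⌉₊ : ℝ) * L / 4 ^ k).card : ℝ)
      ≤ Real.exp (2113929218 * 4 ^ k) := by
  have h4 : (4 : ℝ) ^ k = 2 ^ k * 2 ^ k := by rw [← mul_pow]; norm_num
  have h24 : (2 : ℝ) ^ k ≤ 4 ^ k := pow_le_pow_left₀ (by norm_num) (by norm_num) k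
  have h1 : (1 : ℝ) ≤ 4 ^ k := one_le_pow₀ (by norm_num)
  have hsub : T.image (fun x => (⌈s x * 4 ^ k / L⌉₊ : ℝ) * L / 4 ^ k) ⊆
      (Finset.range (2113929216 * 2 ^ k + 1)).image fun j : ℕ => (j : ℝ) * L / 4 ^ k := by
    intro u hu
    obtain ⟨x, hx, rfl⟩ := Finset.mem_image.1 hu
    refine Finset.mem_image.2 ⟨_, Finset.mem_range.2 (Nat.lt_succ_of_le (Nat.ceil_le.2 ?_)), rfl⟩
    rw [div_le_iff₀ hL]
    calc s x * 4 ^ k ≤ 2113929216 * L / 2 ^ k * 4 ^ k := by gcongr; exact hs x hx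
      _ = _ := by rw [h4]; push_cast; field_simp
  have hcard : ((T.image fun x => (⌈s x * 4 ^ k / L⌉₊ : ℝ) * L / 4 ^ k).card : ℝ)
      ≤ 2113929216 * 2 ^ k + 1 := by
    have := (Finset.card_le_card hsub).trans Finset.card_image_le
    rw [Finset.card_range] at this
    exact_mod_cast this
  have := Real.add_one_le_exp (2113929218 * (4 : ℝ) ^ k)
  linarith

/-- The generic chaining bound over a finite set, for arbitrary selections of points. -/
lemma ChainBounds.sum_selection_le (H : ChainBounds φ ψ K M a b) {k₀ : ℕ} (hn : n ≤ 4 ^ k₀)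
    (hk₀ : (k₀ : ℝ) ≤ 3 * a) (T : Finset (Fin n → ℝ)) (hT : ∀ x ∈ T, ∑ j, x j ^ 2 ≤ 1)
    (hTK : ∀ x ∈ T, ∑ i, φ i x ^ 2 ≤ K ^ 2) (p : (Fin m → Bool) → Fin n → ℝ)
    (hp : ∀ ξ, p ξ ∈ T) :
    (∑ ξ, signSum (fun i => φ i (p ξ) ^ 2) ξ) / 2 ^ m ≤ 10 ^ 22 * (M * K * √(a * b)) := by
  have hK := H.K_pos
  have hM := H.M_pos
  have ha := H.a_ge
  have hb := H.b_ge
  have ha0 : 0 < a := by linarith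
  have hb0 : 0 < b := by linarith
  set L := M * K * √(a * b) with hL
  have hL0 : 0 < L := by positivity
  have hLsq : L ^ 2 = M ^ 2 * K ^ 2 * (a * b) := by
    rw [hL, mul_pow, Real.sq_sqrt (by positivity)]; ring
  have hMK : M * K ≤ 2 * L := by
    have : (1 / 2 : ℝ) ≤ √(a * b) := Real.le_sqrt_of_sq_le (by nlinarith)
    rw [hL]
    nlinarith [mul_pos hM hK]
  set t : ℝ := 1 / (1056964608 * L) with ht
  have ht0 : 0 < t := by positivity
  have hE : ∀ x ∈ T, chainEnergy φ K x ≤ 2 := fun x hx => by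
    have h1 := hT x hx
    have h2 : (∑ i, φ i x ^ 2) / K ^ 2 ≤ 1 := (div_le_one (by positivity)).2 (hTK x hx)
    simp only [chainEnergy]
    linarith
  choose π hπ using fun (k : ℕ) (x : Fin n → ℝ) =>
    exists_chain_minimizer φ H.continuous K (show 0 ≤ 2 ^ k * t by positivity) x
  have htk : ∀ k : ℕ, 2 ^ k * t = 2 ^ k / (1056964608 * L) := fun k => by rw [ht]; ring
  set s : ℕ → (Fin n → ℝ) → ℝ := fun k x => chainDist φ x (π k x) with hs
  set σ : ℕ → (Fin n → ℝ) → ℝ := fun k x => (⌈s k x * 4 ^ k / L⌉₊ : ℝ) * L / 4 ^ k with hσ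
  have hs0 : ∀ k x, 0 ≤ s k x := fun k x => chainDist_nonneg φ x (π k x)
  have hσ0 : ∀ k x, 0 ≤ σ k x := fun k x => by simp only [hσ]; positivity
  have hsσ : ∀ k x, s k x ≤ σ k x := fun k x => by
    have := Nat.le_ceil (s k x * 4 ^ k / L)
    rw [div_le_iff₀ hL0] at this
    exact (le_div_iff₀ (by positivity)).2 this
  have hσs : ∀ k x, σ k x ≤ s k x + L * (1 / 4) ^ k := fun k x => by
    have h1 : 0 ≤ s k x * 4 ^ k / L := by have := hs0 k x; positivity
    have h2 := (Nat.ceil_lt_add_one h1).le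
    calc σ k x ≤ (s k x * 4 ^ k / L + 1) * L / 4 ^ k := by simp only [hσ]; gcongr
      _ = s k x + L * (1 / 4) ^ k := by rw [one_div, inv_pow]; field_simp
  set e : ℕ → ℝ := fun k => 16 * (L * ((1 / 2) ^ (k - k₀)) ^ 2 / (a * 2 ^ k)) with he
  have he0 : ∀ k, 0 ≤ e k := fun k => by simp only [he]; positivity
  obtain ⟨ℓ, h0, hnest, hcard, hDeq, hD⟩ := exists_nested_labels T (chainDist φ) σ e
    (Δ₀ := 8 * L) (c := 2113929218) (by norm_num) hσ0 he0 (by positivity)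
    (fun x hx y hy => (H.chainDist_le (hT x hx) (hT y hy) (hTK x hx) (hTK y hy)).trans
      (by linarith))
    (fun k => card_image_ceil_le T (s k) hL0 k fun x hx => by
      have h1 := hπ k x x
      have h2 := chainEnergy_nonneg φ K (π k x)
      rw [chainDist_self, mul_zero, add_zero] at h1
      have h3 : 2 ^ k * t * s k x ≤ 2 := by
        have := hE x hx
        simp only [hs]
        linarith
      rw [htk, div_mul_eq_mul_div, div_le_iff₀ (by positivity)] at h3
      rw [le_div_iff₀ (by positivity)]
      linarith)
    (fun k A hA τ Δ hτ hΔ hAτ hAΔ => exists_refining_label H hn hL0 hLsq (π k)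
      (fun x z => by rw [← htk]; exact hπ k x z) hτ hΔ A
      (fun x hx => (hsσ k x).trans (hAτ x hx).le) hAΔ fun x hx => hE x (hA hx))
  have hsum : ∀ x ∈ T, ∀ N, ∑ k ∈ Finset.range N, 2 ^ k * cellDiam σ e (8 * L) k x
      ≤ 400000000000 * L := by
    intro x hx N
    have h1 := sum_cellDiam_le hσ0 he0 (by positivity : 0 < 8 * L) x N
    have h2 : ∑ k ∈ Finset.range N, 2 ^ k * s k x ≤ 4227858432 * L := by
      have h := sum_penalty_mul_dist_le ht0.le (fun k => hπ k x) N
      have h' : ∑ k ∈ Finset.range N, 2 ^ k * (t * chainDist φ x (π k x))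
          = t * ∑ k ∈ Finset.range N, 2 ^ k * s k x := by
        rw [Finset.mul_sum]
        exact Finset.sum_congr rfl fun k _ => by simp only [hs]; ring
      rw [h', ht, div_mul_eq_mul_div, div_le_iff₀ (by positivity), one_mul] at h
      nlinarith [hE x hx]
    have hgeom : ∑ k ∈ Finset.range N, 2 ^ k * (L * (1 / 4) ^ k) ≤ 2 * L := by
      have h := sum_geometric_two_le N
      calc _ = L * ∑ k ∈ Finset.range N, (1 / 2 : ℝ) ^ k := by
            rw [Finset.mul_sum]
            refine Finset.sum_congr rfl fun k _ => ?_
            have : (1 / 2 : ℝ) ^ k = 2 ^ k * (1 / 4) ^ k := by rw [← mul_pow]; norm_num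
            rw [this]; ring
        _ ≤ L * 2 := by gcongr
        _ = 2 * L := by ring
    have h3 : ∑ k ∈ Finset.range N, 2 ^ k * σ k x ≤ 4227858434 * L := by
      calc _ ≤ ∑ k ∈ Finset.range N, (2 ^ k * s k x + 2 ^ k * (L * (1 / 4) ^ k)) := by
            refine Finset.sum_le_sum fun k _ => ?_
            rw [← mul_add]
            exact mul_le_mul_of_nonneg_left (hσs k x) (by positivity)
        _ ≤ 4227858432 * L + 2 * L := by
            rw [Finset.sum_add_distrib]; exact add_le_add h2 hgeom
        _ = _ := by ring
    have h4 : ∑ k ∈ Finset.range N, 2 ^ k * e k ≤ 112 * L := by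
      calc _ = 16 * L / a * ∑ k ∈ Finset.range N, (((1 / 2 : ℝ)) ^ (k - k₀)) ^ 2 := by
            rw [Finset.mul_sum]
            refine Finset.sum_congr rfl fun k _ => ?_
            simp only [he]
            field_simp
        _ ≤ 16 * L / a * (7 * a) := by
            gcongr
            exact (sum_pow_tsub_le k₀ N).trans (by linarith)
        _ = 112 * L := by field_simp; ring
    linarith
  have key := sum_signSum_selection_le (fun x i => φ i x ^ 2) T ℓ (cellDiam σ e (8 * L))
    (b := 2113929218 + 3) (W := 400000000000 * L) (by norm_num)
    (fun k x _ => cellDiam_pos hσ0 he0 (by positivity) k x) h0 hnest hcard hDeq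
    (fun k x hx y hy hxy => (sum_sq_sub_sq_le φ x y).trans
      (pow_le_pow_left₀ (chainDist_nonneg φ x y) (hD k x hx y hy hxy) 2)) hsum p hp
  refine key.trans ?_
  rw [← mul_assoc]
  gcongr
  norm_num

end Chaining

section Assembly

open MeasureTheory Filter Topology

variable {n s m : ℕ}

/-- The seminorm `x ↦ max_{j ∈ S} w j * |⟨A j, x⟩|`, for weights `0 ≤ w j`. -/
noncomputable def maxFormSeminorm (A : Matrix (Fin s) (Fin n) ℝ) (S : Finset (Fin s))
    (w : Fin s → ℝ) : Seminorm ℝ (Fin n → ℝ) :=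
  S.sup fun j => (w j).toNNReal •
    (normSeminorm ℝ ℝ).comp ((LinearMap.proj j).comp A.mulVecLin)

lemma exists_maxFormSeminorm_eq (A : Matrix (Fin s) (Fin n) ℝ) {S : Finset (Fin s)}
    (hS : S.Nonempty) {w : Fin s → ℝ} (hw : ∀ j ∈ S, 0 ≤ w j) (x : Fin n → ℝ) :
    ∃ j ∈ S, maxFormSeminorm A S w x = w j * |A j ⬝ᵥ x| := by
  obtain ⟨j, hj, h⟩ := Seminorm.exists_apply_eq_finset_sup (fun j => (w j).toNNReal •
    (normSeminorm ℝ ℝ).comp ((LinearMap.proj j).comp A.mulVecLin)) hS x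
  refine ⟨j, hj, h.trans ?_⟩
  simp [NNReal.smul_def, hw j hj, Matrix.mulVec]

lemma le_maxFormSeminorm (A : Matrix (Fin s) (Fin n) ℝ) {S : Finset (Fin s)}
    {w : Fin s → ℝ} {j : Fin s} (hj : j ∈ S) (hw : 0 ≤ w j) (x : Fin n → ℝ) :
    w j * |A j ⬝ᵥ x| ≤ maxFormSeminorm A S w x := by
  have h := Seminorm.le_finset_sup_apply (p := fun j => (w j).toNNReal •
    (normSeminorm ℝ ℝ).comp ((LinearMap.proj j).comp A.mulVecLin)) (x := x) hj
  refine le_trans (le_of_eq ?_) h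
  simp [NNReal.smul_def, hw, Matrix.mulVec]

lemma iSup_mem_eq_maxFormSeminorm (A : Matrix (Fin s) (Fin n) ℝ) {S : Finset (Fin s)}
    (hS : S.Nonempty) {w : Fin s → ℝ} (hw : ∀ j ∈ S, 0 ≤ w j) (x : Fin n → ℝ) :
    ⨆ j ∈ S, w j * |A j ⬝ᵥ x| = maxFormSeminorm A S w x := by
  refine le_antisymm (Real.iSup_le (fun j => Real.iSup_le (fun hj =>
    le_maxFormSeminorm A hj (hw j hj) x) (apply_nonneg _ _)) (apply_nonneg _ _)) ?_
  obtain ⟨j, hj, h⟩ := exists_maxFormSeminorm_eq A hS hw x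
  rw [h]
  refine le_trans (le_of_eq ?_) (le_ciSup (Set.finite_range _).bddAbove j)
  rw [ciSup_pos hj]

lemma iSup_abs_mulVec_eq_maxFormSeminorm [Nonempty (Fin s)] (A : Matrix (Fin s) (Fin n) ℝ)
    (x : Fin n → ℝ) :
    ⨆ j, |(A *ᵥ x) j| = maxFormSeminorm A Finset.univ (fun _ => 1) x := by
  rw [← iSup_mem_eq_maxFormSeminorm A Finset.univ_nonempty (fun _ _ => zero_le_one)]
  simp [Matrix.mulVec]

lemma dotProduct_sq_le (u x : Fin n → ℝ) : (u ⬝ᵥ x) ^ 2 ≤ (∑ i, u i ^ 2) * ∑ i, x i ^ 2 :=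
  Finset.sum_mul_sq_le_sq_mul_sq _ _ _

lemma maxFormSeminorm_sq_le (A : Matrix (Fin s) (Fin n) ℝ) {S : Finset (Fin s)}
    (hS : S.Nonempty) {w : Fin s → ℝ} (hw : ∀ j ∈ S, 0 ≤ w j ∧ w j ≤ 1) {M : ℝ}
    (hM : ∀ j, ∑ i, A j i ^ 2 ≤ M ^ 2) (x : Fin n → ℝ) :
    maxFormSeminorm A S w x ^ 2 ≤ M ^ 2 * ∑ i, x i ^ 2 := by
  obtain ⟨j, hj, h⟩ := exists_maxFormSeminorm_eq A hS (fun j hj => (hw j hj).1) x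
  rw [h, mul_pow, sq_abs]
  have h1 := hw j hj
  have h2 : w j ^ 2 ≤ 1 := pow_le_one₀ h1.1 h1.2
  have h3 := (dotProduct_sq_le (A j) x).trans
    (mul_le_mul_of_nonneg_right (hM j) (Finset.sum_nonneg fun i _ => sq_nonneg (x i)))
  nlinarith [sq_nonneg (A j ⬝ᵥ x)]

/-- The rows of `A` have Euclidean norm at most `‖A‖_{2→∞}`. -/
lemma row_sq_le (A : Matrix (Fin s) (Fin n) ℝ) (ψ : Seminorm ℝ (Fin n → ℝ))
    (hψ : ∀ j x, |A j ⬝ᵥ x| ≤ ψ x) {M : ℝ}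
    (hM : ∀ x : Fin n → ℝ, ∑ i, x i ^ 2 ≤ 1 → ψ x ≤ M) (j : Fin s) :
    ∑ i, A j i ^ 2 ≤ M ^ 2 := by
  set r := √(∑ i, A j i ^ 2) with hr
  have hr2 : r ^ 2 = ∑ i, A j i ^ 2 := Real.sq_sqrt (Finset.sum_nonneg fun _ _ => sq_nonneg _)
  rcases (Real.sqrt_nonneg (∑ i, A j i ^ 2)).eq_or_lt with h0 | h0
  · rw [← hr2, hr, ← h0]; simpa using sq_nonneg M
  · rw [← hr] at h0
    rw [← hr2]
    refine pow_le_pow_left₀ h0.le ?_ 2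
    have h1 : ∑ i, (r⁻¹ • A j) i ^ 2 = 1 := by
      simp only [Pi.smul_apply, smul_eq_mul, mul_pow]
      rw [← Finset.mul_sum, ← hr2]
      field_simp
    have h2 : A j ⬝ᵥ (r⁻¹ • A j) = r := by
      rw [dotProduct_smul, smul_eq_mul]
      have : A j ⬝ᵥ A j = r ^ 2 := by
        rw [hr2]; exact Finset.sum_congr rfl fun i _ => (sq _).symm
      rw [this]
      field_simp
    calc r = |A j ⬝ᵥ (r⁻¹ • A j)| := by rw [h2, abs_of_pos h0]
      _ ≤ M := (hψ j _).trans (hM _ h1.le)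

lemma chainBounds_maxFormSeminorm (A : Matrix (Fin s) (Fin n) ℝ) (hs : 1 ≤ s) (hn : 1 ≤ n)
    (S : Fin m → Finset (Fin s)) (w : Fin m → Fin s → ℝ) (hS : ∀ i, (S i).Nonempty)
    (hw : ∀ i, ∀ j ∈ S i, 0 ≤ w i j ∧ w i j ≤ 1) {D : ℕ} (hD : 2 ≤ D)
    (hSD : ∀ i, (S i).card ≤ D) {M K : ℝ} (hM : 0 < M) (hK : 0 < K)
    (hAM : ∀ j, ∑ i, A j i ^ 2 ≤ M ^ 2) :
    ChainBounds (fun i => maxFormSeminorm A (S i) (w i))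
      (maxFormSeminorm A Finset.univ fun _ => 1) K M (Real.log ((s : ℝ) + n)) (Real.log D) := by
  have : Nonempty (Fin s) := ⟨⟨0, hs⟩⟩
  have hlog : ∀ d : ℝ, 2 ≤ d → 1 / 2 ≤ Real.log d := fun d hd => by
    have := Real.log_two_gt_d9
    have := Real.log_le_log (by norm_num) hd
    linarith
  have hD' : (2 : ℝ) ≤ D := by exact_mod_cast hD
  have hsn : (2 : ℝ) ≤ (s : ℝ) + n := by
    have h1 : (1 : ℝ) ≤ s := by exact_mod_cast hs
    have h2 : (1 : ℝ) ≤ n := by exact_mod_cast hn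
    linarith
  have hψle := maxFormSeminorm_sq_le A Finset.univ_nonempty (w := fun _ => 1)
    (fun _ _ => ⟨zero_le_one, le_rfl⟩) hAM
  have hφle := fun i => maxFormSeminorm_sq_le A (hS i) (hw i) hAM
  have hφ := fun i => integral_sq_max_le (S i) A hM (fun j _ => hAM j) hD'
    (by exact_mod_cast hSD i) (maxFormSeminorm A (S i) (w i))
    (continuous_seminorm_of_sq_le _ (hφle i)) (fun x => apply_nonneg _ x) fun x => by
      obtain ⟨j, hj, h⟩ := exists_maxFormSeminorm_eq A (hS i) (fun j hj => (hw i j hj).1) x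
      exact ⟨j, hj, h.trans_le (mul_le_of_le_one_left (abs_nonneg _) (hw i j hj).2)⟩
  have hψ := integral_sq_max_le Finset.univ A hM (fun j _ => hAM j) hsn
    (by simp) (maxFormSeminorm A Finset.univ fun _ => 1)
    (continuous_seminorm_of_sq_le _ hψle) (fun x => apply_nonneg _ x) fun x => by
      obtain ⟨j, hj, h⟩ := exists_maxFormSeminorm_eq A Finset.univ_nonempty
        (w := fun _ => 1) (fun _ _ => zero_le_one) x
      exact ⟨j, hj, by rw [h, one_mul]⟩
  exact
    { K_pos := hK
      M_pos := hM
      a_ge := hlog _ hsn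
      b_ge := hlog _ hD'
      le := fun i x => by
        obtain ⟨j, hj, h⟩ := exists_maxFormSeminorm_eq A (hS i) (fun j hj => (hw i j hj).1) x
        rw [h]
        refine (mul_le_mul_of_nonneg_right (hw i j hj).2 (abs_nonneg _)).trans ?_
        exact le_maxFormSeminorm A (w := fun _ => 1) (Finset.mem_univ j) zero_le_one x
      le_norm := hψle
      integrable_sq := fun i => (hφ i).1
      integral_sq_le := fun i => (hφ i).2
      integrable_sq_max := hψ.1
      integral_sq_max_le := hψ.2 }

lemma exists_nat_le_four_pow (hs : 1 ≤ s) (hn : 1 ≤ n) :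
    ∃ k : ℕ, n ≤ 4 ^ k ∧ (k : ℝ) ≤ 3 * Real.log ((s : ℝ) + n) := by
  have h1 : (1 : ℝ) ≤ s := by exact_mod_cast hs
  have h2 : (1 : ℝ) ≤ n := by exact_mod_cast hn
  have hlog : Real.log 2 ≤ Real.log ((s : ℝ) + n) := Real.log_le_log (by norm_num) (by linarith)
  have hl2 := Real.log_two_gt_d9
  refine ⟨⌈Real.log ((s : ℝ) + n)⌉₊, ?_, ?_⟩
  · have h : (n : ℝ) ≤ 4 ^ ⌈Real.log ((s : ℝ) + n)⌉₊ := by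
      calc (n : ℝ) ≤ (s : ℝ) + n := by linarith
        _ = Real.exp (Real.log ((s : ℝ) + n)) := (Real.exp_log (by linarith)).symm
        _ ≤ Real.exp ⌈Real.log ((s : ℝ) + n)⌉₊ := Real.exp_le_exp.2 (Nat.le_ceil _)
        _ = Real.exp 1 ^ ⌈Real.log ((s : ℝ) + n)⌉₊ := by rw [← Real.exp_nat_mul, mul_one]
        _ ≤ 4 ^ ⌈Real.log ((s : ℝ) + n)⌉₊ := by
          have := Real.exp_one_lt_d9
          gcongr
          linarith
    exact_mod_cast h
  · have := (Nat.ceil_lt_add_one (show 0 ≤ Real.log ((s : ℝ) + n) by linarith)).le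
    linarith

lemma sum_sSup_le_of_selection {α : Type*} (c : α → Fin m → ℝ) (T : Set α) (hT : T.Nonempty)
    {B ε : ℝ} (hε : 0 < ε)
    (h : ∀ p : (Fin m → Bool) → α, (∀ ξ, p ξ ∈ T) → (∑ ξ, signSum (c (p ξ)) ξ) / 2 ^ m ≤ B) :
    (∑ ξ : Fin m → Bool, sSup ((fun x => signSum (c x) ξ) '' T)) / 2 ^ m ≤ ε + B := by
  have hex : ∀ ξ : Fin m → Bool, ∃ x ∈ T,
      sSup ((fun x => signSum (c x) ξ) '' T) ≤ ε + signSum (c x) ξ := fun ξ => by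
    obtain ⟨_, ⟨x, hx, rfl⟩, hlt⟩ := exists_lt_of_lt_csSup (hT.image fun x => signSum (c x) ξ)
      (sub_lt_self _ hε)
    exact ⟨x, hx, by simp only at hlt; linarith⟩
  choose p hpT hp using hex
  calc _ ≤ (∑ ξ, (ε + signSum (c (p ξ)) ξ)) / 2 ^ m := by
        gcongr with ξ
        exact hp ξ
    _ = ε + (∑ ξ, signSum (c (p ξ)) ξ) / 2 ^ m := by
        rw [Finset.sum_add_distrib, add_div]
        simp
    _ ≤ ε + B := by have := h p hpT; linarith

end Assembly

/-- **Generic chaining bound for max-of-linear-forms processes.** There is a universal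
constant `C₀ > 0` such that for every linear map `A : ℝⁿ → ℝˢ` with rows `a_j`, functions
`φ_i(x) = max_{j ∈ S_i} w^{(i)}_j |⟨a_j, x⟩|` (with `S_i ⊆ [s]` nonempty,
`w^{(i)} ∈ [0,1]^{S_i}`, and `D = max_i |S_i| ≥ 2`), every nonempty `T ⊆ B₂ⁿ`, and i.i.d.
Rademacher signs `ξ_1, …, ξ_m`,
`E[sup_{x∈T} Σ_i ξ_i φ_i(x)²] ≤ C₀ ‖A‖_{2→∞} √(log(s+n)·log D) · sup_{x∈T} (Σ_i φ_i(x)²)^{1/2}`.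
The expectation over the signs is written as the average over all `ξ : Fin m → Bool`. -/
theorem generic_chaining_max_linear_forms :
    ∃ C₀ : ℝ, 0 < C₀ ∧
      ∀ (n s m : ℕ), 1 ≤ n → 1 ≤ s → 1 ≤ m →
      ∀ (A : Matrix (Fin s) (Fin n) ℝ) (S : Fin m → Finset (Fin s))
        (wgt : Fin m → Fin s → ℝ),
      (∀ i, (S i).Nonempty) →
      (∀ i, ∀ j ∈ S i, 0 ≤ wgt i j ∧ wgt i j ≤ 1) →
      2 ≤ (Finset.univ : Finset (Fin m)).sup (fun i => (S i).card) →
      ∀ T : Set (Fin n → ℝ), T.Nonempty → (∀ x ∈ T, ∑ i, (x i) ^ 2 ≤ 1) →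
      (∑ ξ : Fin m → Bool,
          sSup ((fun x => ∑ i, (if ξ i then (1 : ℝ) else -1) *
            (⨆ j ∈ S i, wgt i j * |A j ⬝ᵥ x|) ^ 2) '' T)) / 2 ^ m
        ≤ C₀ *
          sSup ((fun x => ⨆ j : Fin s, |(A *ᵥ x) j|) ''
            {x : Fin n → ℝ | ∑ i, (x i) ^ 2 ≤ 1}) *
          Real.sqrt (Real.log ((s : ℝ) + (n : ℝ)) *
            Real.log (((Finset.univ : Finset (Fin m)).sup (fun i => (S i).card) : ℕ))) *
          sSup ((fun x =>
            Real.sqrt (∑ i, (⨆ j ∈ S i, wgt i j * |A j ⬝ᵥ x|) ^ 2)) '' T) := by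
  refine ⟨10 ^ 22, by norm_num, ?_⟩
  intro n s m hn hs _ A S w hS hw hD T hT hT1
  have : Nonempty (Fin s) := ⟨⟨0, hs⟩⟩
  set D := (Finset.univ : Finset (Fin m)).sup fun i => (S i).card with hDdef
  set φ : Fin m → Seminorm ℝ (Fin n → ℝ) := fun i => maxFormSeminorm A (S i) (w i) with hφdef
  set ψ : Seminorm ℝ (Fin n → ℝ) := maxFormSeminorm A Finset.univ fun _ => 1 with hψdef
  have hφ : ∀ i x, ⨆ j ∈ S i, w i j * |A j ⬝ᵥ x| = φ i x := fun i x =>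
    iSup_mem_eq_maxFormSeminorm A (hS i) (fun j hj => (hw i j hj).1) x
  simp only [hφ, iSup_abs_mulVec_eq_maxFormSeminorm A, ← hψdef]
  set M := sSup ((fun x => ψ x) '' {x : Fin n → ℝ | ∑ i, x i ^ 2 ≤ 1}) with hMdef
  set K := sSup ((fun x => √(∑ i, φ i x ^ 2)) '' T) with hKdef
  set N := √(∑ j, ∑ i, A j i ^ 2) with hN
  have hAN : ∀ j, ∑ i, A j i ^ 2 ≤ N ^ 2 := fun j => by
    rw [hN, Real.sq_sqrt (by positivity)]
    exact Finset.single_le_sum (f := fun j => ∑ i, A j i ^ 2) (fun j _ => by positivity)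
      (Finset.mem_univ j)
  have hN0 : 0 ≤ N := Real.sqrt_nonneg _
  have hψM : ∀ x : Fin n → ℝ, ∑ i, x i ^ 2 ≤ 1 → ψ x ≤ M := fun x hx => by
    refine le_csSup ⟨N, ?_⟩ ⟨x, hx, rfl⟩
    rintro _ ⟨y, hy, rfl⟩
    have h := maxFormSeminorm_sq_le A Finset.univ_nonempty (w := fun _ => 1)
      (fun _ _ => ⟨zero_le_one, le_rfl⟩) hAN y
    exact le_of_sq_le_sq (h.trans (mul_le_of_le_one_right (sq_nonneg N) hy)) hN0
  have hM0 : 0 ≤ M := by simpa using hψM 0 (by simp)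
  have hAM : ∀ j, ∑ i, A j i ^ 2 ≤ M ^ 2 := row_sq_le A ψ
    (fun j x => by
      simpa using le_maxFormSeminorm A (w := fun _ => 1) (Finset.mem_univ j) zero_le_one x) hψM
  have hφK : ∀ x ∈ T, √(∑ i, φ i x ^ 2) ≤ K := fun x hx => by
    refine le_csSup ⟨√(∑ _i : Fin m, M ^ 2), ?_⟩ ⟨x, hx, rfl⟩
    rintro _ ⟨y, hy, rfl⟩
    refine Real.sqrt_le_sqrt (Finset.sum_le_sum fun i _ => ?_)
    exact (maxFormSeminorm_sq_le A (hS i) (hw i) hAM y).trans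
      (mul_le_of_le_one_right (sq_nonneg M) (hT1 y hy))
  have hK0 : 0 ≤ K := by
    obtain ⟨x, hx⟩ := hT
    exact (Real.sqrt_nonneg _).trans (hφK x hx)
  obtain ⟨k₀, hk₀, hk₀'⟩ := exists_nat_le_four_pow hs hn
  set R := √(Real.log ((s : ℝ) + n) * Real.log D) with hR
  have hbound : ∀ ε : ℝ, 0 < ε →
      (∑ ξ : Fin m → Bool, sSup ((fun x => signSum (fun i => φ i x ^ 2) ξ) '' T)) / 2 ^ m
        ≤ ε + 10 ^ 22 * ((M + ε) * (K + ε) * R) := fun ε hε => by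
    have H := chainBounds_maxFormSeminorm A hs hn S w hS hw hD
      (fun i => Finset.le_sup (f := fun i => (S i).card) (Finset.mem_univ i))
      (M := M + ε) (K := K + ε) (by positivity) (by positivity)
      (fun j => (hAM j).trans (by gcongr; linarith))
    refine sum_sSup_le_of_selection _ T hT hε fun p hp => ?_
    refine H.sum_selection_le hk₀ hk₀' (Finset.univ.image p) (fun x hx => ?_) (fun x hx => ?_) p
      fun ξ => Finset.mem_image_of_mem _ (Finset.mem_univ ξ)
    · obtain ⟨ξ, -, rfl⟩ := Finset.mem_image.1 hx
      exact hT1 _ (hp ξ)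
    · obtain ⟨ξ, -, rfl⟩ := Finset.mem_image.1 hx
      exact (Real.sqrt_le_left (by positivity)).1 ((hφK _ (hp ξ)).trans (by linarith))
  have hlim : Filter.Tendsto (fun ε : ℝ => ε + 10 ^ 22 * ((M + ε) * (K + ε) * R))
      (nhdsWithin 0 (Set.Ioi 0)) (nhds (10 ^ 22 * M * R * K)) := by
    have hc : Continuous fun ε : ℝ => ε + 10 ^ 22 * ((M + ε) * (K + ε) * R) := by fun_prop
    have h := (hc.tendsto 0).mono_left (nhdsWithin_le_nhds (s := Set.Ioi 0))
    convert h using 2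
    ring
  exact ge_of_tendsto hlim (Filter.eventually_of_mem self_mem_nhdsWithin hbound)
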